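/- Let k ∈ (0, k_max) and b := V(k). A number θ₂ < 0 attains max_{θ₂<0} (k + G(θ₂))/θ₂ if and only if it attains sup_{θ₂∈ℝ} [θ₂·b − G(θ₂)]. A pair (θ₁,θ₂) with θ₂ < 0 attains max_{θ₂<0} max_{θ₁∈ℝ} (k + K(θ₁,θ₂) − θ₁)/θ₂ if and only if it attains sup_{(θ₁,θ₂)} [θ₁ + θ₂·b − K(θ₁,θ₂)]. Any such pair (θ₁,θ₂) belongs to Θ and satisfies ∫ p_{θ₁,θ₂} dμ ≤ 1. -/

import Mathlib

open MeasureTheory Filter Set Topology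
open scoped ENNReal

noncomputable section

variable {Ω : Type*} [MeasurableSpace Ω]

/-- The positive part of an extended real number, as a member of `ℝ≥0∞`. -/
def ePos (x : EReal) : ℝ≥0∞ := if x = ⊤ then ⊤ else ENNReal.ofReal x.toReal

/-- The (signed) integral of an extended-real-valued function: the integral of its
positive part minus the integral of its negative part. -/
def eInt (μ : Measure Ω) (f : Ω → EReal) : EReal :=
  ((∫⁻ r, ePos (f r) ∂μ : ℝ≥0∞) : EReal) - ((∫⁻ r, ePos (-(f r)) ∂μ : ℝ≥0∞) : EReal)

/-- `p` is a probability density with respect to `μ`. -/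
def IsDensity (μ : Measure Ω) (p : Ω → ℝ) : Prop :=
  Measurable p ∧ (∀ r, 0 ≤ p r) ∧ ∫⁻ r, ENNReal.ofReal (p r) ∂μ = 1

/-- `∫ p dμ` for a nonnegative function `p`. -/
def pInt (μ : Measure Ω) (p : Ω → ℝ) : ℝ≥0∞ := ∫⁻ r, ENNReal.ofReal (p r) ∂μ

/-- The convex integral functional `H(p) = ∫ β(r, p(r)) μ(dr)`. -/
def Hfun (μ : Measure Ω) (β : Ω → ℝ → EReal) (p : Ω → ℝ) : EReal :=
  eInt μ (fun r => β r (p r))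

/-- The expected payoff `∫ X p dμ`, as an extended real number. -/
def xInt (μ : Measure Ω) (X p : Ω → ℝ) : EReal :=
  eInt μ (fun r => ((X r * p r : ℝ) : EReal))

/-- The value function `F(b) = inf { H(p) : p density, ∫ X p dμ = b }`. -/
def Ffun (μ : Measure Ω) (β : Ω → ℝ → EReal) (X : Ω → ℝ) (b : ℝ) : EReal :=
  ⨅ p : {p : Ω → ℝ // IsDensity μ p ∧ xInt μ X p = (b : EReal)}, Hfun μ β p.1

/-- The essential infimum `m` of `X`, as an extended real number. -/
def essInfX (μ : Measure Ω) (X : Ω → ℝ) : EReal := essInf (fun r => (X r : EReal)) μ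

/-- The essential supremum `M` of `X`, as an extended real number. -/
def essSupX (μ : Measure Ω) (X : Ω → ℝ) : EReal := essSup (fun r => (X r : EReal)) μ

/-- `k_max = lim_{b ↓ m} F(b)`; since `F` is nonincreasing on `(m, b₀)`, this limit
equals the supremum of `F` over `(m, b₀)`. -/
def kmax (μ : Measure Ω) (β : Ω → ℝ → EReal) (X : Ω → ℝ) (b₀ : ℝ) : EReal :=
  ⨆ b : {b : ℝ // essInfX μ X < (b : EReal) ∧ b < b₀}, Ffun μ β X b

/-- `V(k) = inf { ∫ X p dμ : p density, H(p) ≤ k }`. -/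
def Vfun (μ : Measure Ω) (β : Ω → ℝ → EReal) (X : Ω → ℝ) (k : ℝ) : EReal :=
  ⨅ p : {p : Ω → ℝ // IsDensity μ p ∧ Hfun μ β p ≤ (k : EReal)}, xInt μ X p.1

/-- `W(λ) = inf { ∫ X p dμ + λ H(p) : p density }`. -/
def Wfun (μ : Measure Ω) (β : Ω → ℝ → EReal) (X : Ω → ℝ) (lam : ℝ) : EReal :=
  ⨅ p : {p : Ω → ℝ // IsDensity μ p}, (xInt μ X p.1 + (lam : EReal) * Hfun μ β p.1)

/-- The convex conjugate `β*(r, τ) = sup_s (sτ − β(r,s))` of `β` in its second variable. -/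
def conjβ (β : Ω → ℝ → EReal) (r : Ω) (τ : ℝ) : EReal :=
  ⨆ s : ℝ, (((s * τ : ℝ) : EReal) - β r s)

/-- `K(θ₁, θ₂) = ∫ β*(r, θ₁ + θ₂ X(r)) μ(dr)`. -/
def Kfun (μ : Measure Ω) (β : Ω → ℝ → EReal) (X : Ω → ℝ) (θ₁ θ₂ : ℝ) : EReal :=
  eInt μ (fun r => conjβ β r (θ₁ + θ₂ * X r))

/-- `dom K = {(θ₁, θ₂) : K(θ₁,θ₂) < +∞}`. -/
def domK (μ : Measure Ω) (β : Ω → ℝ → EReal) (X : Ω → ℝ) : Set (ℝ × ℝ) :=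
  {θ : ℝ × ℝ | Kfun μ β X θ.1 θ.2 < ⊤}

/-- `β'(r, +∞) = lim_{s ↑ ∞} β'(r,s)`; by monotonicity of the derivative of a convex
function this equals the supremum of `β'(r, ·)` over `(0, ∞)`. -/
def derivTop (β' : Ω → ℝ → ℝ) (r : Ω) : EReal := ⨆ s : {s : ℝ // 0 < s}, (β' r s.1 : EReal)

/-- `β'(r, 0) = lim_{s ↓ 0} β'(r,s)`, the infimum of `β'(r, ·)` over `(0, ∞)`. -/
def derivZero (β' : Ω → ℝ → ℝ) (r : Ω) : EReal := ⨅ s : {s : ℝ // 0 < s}, (β' r s.1 : EReal)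

/-- The parameter set `Θ`. -/
def ThetaSet (μ : Measure Ω) (β : Ω → ℝ → EReal) (β' : Ω → ℝ → ℝ) (X : Ω → ℝ) :
    Set (ℝ × ℝ) :=
  {θ ∈ domK μ β X | ∀ᵐ r ∂μ, ((θ.1 + θ.2 * X r : ℝ) : EReal) < derivTop β' r}

/-- The generalised exponential family member `p_{θ₁,θ₂}(r) = (β*)'(r, θ₁ + θ₂ X(r))`,
where `ψ` denotes the derivative `(β*)'` of the conjugate in its second variable. -/
def pFam (ψ : Ω → ℝ → ℝ) (X : Ω → ℝ) (θ₁ θ₂ : ℝ) : Ω → ℝ :=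
  fun r => ψ r (θ₁ + θ₂ * X r)

/-- `G(θ₂) = inf_{θ₁} [K(θ₁,θ₂) − θ₁]`. -/
def Gfun (μ : Measure Ω) (β : Ω → ℝ → EReal) (X : Ω → ℝ) (θ₂ : ℝ) : EReal :=
  ⨅ θ₁ : ℝ, (Kfun μ β X θ₁ θ₂ - (θ₁ : EReal))

/-- `Θ₂ = dom G`, the projection of `dom K` to the `θ₂`-axis. -/
def Theta2 (μ : Measure Ω) (β : Ω → ℝ → EReal) (X : Ω → ℝ) : Set ℝ :=
  {θ₂ : ℝ | Gfun μ β X θ₂ < ⊤}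

/-- The Bregman integrand `Δ_β(r, s, t)`; for `t = 0` it is defined as the limit `t ↓ 0`
(with `β'(r,0) = lim_{t↓0} β'(r,t)`), and if `β(r,0) = +∞` then `Δ_β(r,0,0) = 0` and
`Δ_β(r,s,0) = +∞` for `s > 0`. -/
def bregmanInt (β : Ω → ℝ → EReal) (β' : Ω → ℝ → ℝ) (r : Ω) (s t : ℝ) : EReal :=
  if 0 < t then β r s - β r t - ((β' r t : EReal) * ((s - t : ℝ) : EReal))
  else if β r 0 = ⊤ then (if s = 0 then 0 else ⊤)
  else β r s - β r 0 - derivZero β' r * ((s : ℝ) : EReal)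

/-- The (generalised) Bregman distance `B(p, q)`. -/
def Bdist (μ : Measure Ω) (β : Ω → ℝ → EReal) (β' : Ω → ℝ → ℝ) (p q : Ω → ℝ) : EReal :=
  eInt μ (fun r => bregmanInt β β' r (p r) (q r))

/-- The standing assumptions of the framework: `μ` is σ-finite; `β` is a normal convex
integrand (measurable in `r`; equal to `+∞` for `s < 0`; finite, strictly convex and
differentiable with derivative `β'` on `(0,∞)`; right-continuous at `0`); `p₀` is a
density with finite expected payoff `b₀` satisfying `m < b₀ < M`; `H(p₀) = 0 ≤ H(p)`
for every density `p`; and `k_max > 0`. -/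
structure Standing (μ : Measure Ω) (β : Ω → ℝ → EReal) (β' : Ω → ℝ → ℝ)
    (X : Ω → ℝ) (p₀ : Ω → ℝ) (b₀ : ℝ) : Prop where
  sigma : SigmaFinite μ
  betaMeas : ∀ s : ℝ, Measurable (fun r => β r s)
  Xmeas : Measurable X
  betaNeg : ∀ r : Ω, ∀ s : ℝ, s < 0 → β r s = ⊤
  betaNeBot : ∀ r s, β r s ≠ ⊥
  betaFin : ∀ r : Ω, ∀ s : ℝ, 0 < s → β r s ≠ ⊤
  betaZero : ∀ r, Tendsto (fun s => β r s) (𝓝[>] (0:ℝ)) (𝓝 (β r 0))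
  betaConv : ∀ r, StrictConvexOn ℝ (Ioi (0:ℝ)) (fun s => (β r s).toReal)
  betaDeriv : ∀ r : Ω, ∀ s ∈ Ioi (0:ℝ), HasDerivAt (fun t => (β r t).toReal) (β' r s) s
  dens₀ : IsDensity μ p₀
  payoff₀ : xInt μ X p₀ = (b₀ : EReal)
  mlt : essInfX μ X < (b₀ : EReal)
  ltM : (b₀ : EReal) < essSupX μ X
  H₀ : Hfun μ β p₀ = 0
  Hnonneg : ∀ p, IsDensity μ p → 0 ≤ Hfun μ β p
  kmaxPos : 0 < kmax μ β X b₀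

/-- The hypothesis that `ψ = (β*)'`: at every point `τ < β'(r,+∞)`, where the conjugate
`β*(r,·)` is finite and differentiable, `ψ r τ` is its derivative. -/
def IsConjDeriv (β : Ω → ℝ → EReal) (β' : Ω → ℝ → ℝ) (ψ : Ω → ℝ → ℝ) : Prop :=
  ∀ r : Ω, ∀ τ : ℝ, ((τ : ℝ) : EReal) < derivTop β' r →
    HasDerivAt (fun t => (conjβ β r t).toReal) (ψ r τ) τ

/-- `(θ₁, θ₂)` with `θ₂ < 0` attains the double maximum
`max_{θ₂<0} max_{θ₁} (k + K(θ₁,θ₂) − θ₁)/θ₂` (whose value is `V(k)`); such a pair is a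
parameter pair of the worst case localiser `q̂_k = p_{θ₁,θ₂}`. -/
def IsWCLParam (μ : Measure Ω) (β : Ω → ℝ → EReal) (X : Ω → ℝ) (k : ℝ) (θ₁ θ₂ : ℝ) : Prop :=
  θ₂ < 0 ∧ ∀ θ₁' θ₂' : ℝ, θ₂' < 0 →
    ((k : EReal) + Kfun μ β X θ₁' θ₂' - (θ₁' : EReal)) / ((θ₂' : ℝ) : EReal) ≤
      ((k : EReal) + Kfun μ β X θ₁ θ₂ - (θ₁ : EReal)) / ((θ₂ : ℝ) : EReal)

/-- `p` is an (ε-γ)-almost worst case density for threshold `k`. -/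
def AWCD (μ : Measure Ω) (β : Ω → ℝ → EReal) (X : Ω → ℝ) (k ε γ : ℝ) (p : Ω → ℝ) : Prop :=
  IsDensity μ p ∧ Hfun μ β p ≤ ((k + γ : ℝ) : EReal) ∧
    xInt μ X p ≤ Vfun μ β X k + (ε : EReal)

/-- Convergence locally in measure. -/
def TendstoLocallyInMeasure (μ : Measure Ω) (p : ℕ → Ω → ℝ) (q : Ω → ℝ) : Prop :=
  ∀ C : Set Ω, MeasurableSet C → μ C < ⊤ → ∀ ε : ℝ, 0 < ε →
    Tendsto (fun n => μ {r ∈ C | ε < |p n r - q r|}) atTop (𝓝 0)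

end

section ExtendedIntegral

variable {Ω : Type*} [MeasurableSpace Ω] {μ : Measure Ω}

theorem ePos_coe (x : ℝ) : ePos (x : EReal) = ENNReal.ofReal x := by
  simp [ePos]

theorem ePos_neg_coe (x : ℝ) : ePos (-(x : EReal)) = ENNReal.ofReal (-x) := by
  rw [← EReal.coe_neg, ePos_coe]

theorem ePos_mono {x y : EReal} (h : x ≤ y) : ePos x ≤ ePos y := by
  induction y with
  | top => simp [ePos]
  | bot => rw [le_bot_iff.1 h]
  | coe y =>
    induction x with
    | top => simp at h
    | bot => simp [ePos]
    | coe x =>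
      rw [ePos_coe, ePos_coe]
      exact ENNReal.ofReal_le_ofReal (EReal.coe_le_coe_iff.1 h)

theorem measurable_ePos : Measurable ePos :=
  Measurable.ite (measurableSet_singleton _) measurable_const
    (measurable_ereal_toReal.ennreal_ofReal)

theorem eInt_mono_ae {f g : Ω → EReal} (h : ∀ᵐ r ∂μ, f r ≤ g r) : eInt μ f ≤ eInt μ g := by
  refine EReal.sub_le_sub ?_ ?_
  · exact EReal.coe_ennreal_le_coe_ennreal_iff.2
      (lintegral_mono_ae (h.mono fun r hr => ePos_mono hr))
  · exact EReal.coe_ennreal_le_coe_ennreal_iff.2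
      (lintegral_mono_ae (h.mono fun r hr => ePos_mono (EReal.neg_le_neg_iff.2 hr)))

theorem eInt_congr_ae {f g : Ω → EReal} (h : ∀ᵐ r ∂μ, f r = g r) : eInt μ f = eInt μ g :=
  le_antisymm (eInt_mono_ae (h.mono fun _ hr => hr.le)) (eInt_mono_ae (h.mono fun _ hr => hr.ge))

theorem eInt_coe {f : Ω → ℝ} (hf : Integrable f μ) :
    eInt μ (fun r => (f r : EReal)) = ((∫ r, f r ∂μ : ℝ) : EReal) := by
  have h1 : ∫⁻ r, ENNReal.ofReal (f r) ∂μ ≠ ⊤ := hf.lintegral_lt_top.ne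
  have h2 : ∫⁻ r, ENNReal.ofReal (-f r) ∂μ ≠ ⊤ := hf.neg.lintegral_lt_top.ne
  simp only [eInt, ePos_coe, ePos_neg_coe]
  rw [integral_eq_lintegral_pos_part_sub_lintegral_neg_part hf, EReal.coe_sub,
    EReal.coe_ennreal_toReal h1, EReal.coe_ennreal_toReal h2]

theorem eInt_eq_integral_toReal {f : Ω → EReal} (hf : Integrable (fun r => (f r).toReal) μ)
    (htop : ∀ᵐ r ∂μ, f r ≠ ⊤) (hbot : ∀ᵐ r ∂μ, f r ≠ ⊥) :
    eInt μ f = ((∫ r, (f r).toReal ∂μ : ℝ) : EReal) := by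
  rw [← eInt_coe hf]
  refine eInt_congr_ae ?_
  filter_upwards [htop, hbot] with r h1 h2
  exact (EReal.coe_toReal h1 h2).symm

theorem lintegral_ePos_ne_top_of_eInt {f : Ω → EReal}
    (htop : eInt μ f ≠ ⊤) (hbot : eInt μ f ≠ ⊥) :
    ∫⁻ r, ePos (f r) ∂μ ≠ ⊤ ∧ ∫⁻ r, ePos (-(f r)) ∂μ ≠ ⊤ := by
  have h2 : ∫⁻ r, ePos (-(f r)) ∂μ ≠ ⊤ := by
    intro h
    apply hbot
    simp [eInt, h]
  refine ⟨fun h => htop ?_, h2⟩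
  rw [eInt, h, ← EReal.coe_ennreal_toReal h2, EReal.coe_ennreal_top, EReal.top_sub_coe]

theorem integrable_toReal_of_lintegral_ePos {f : Ω → EReal} (hf : Measurable f)
    (h1 : ∫⁻ r, ePos (f r) ∂μ ≠ ⊤) (h2 : ∫⁻ r, ePos (-(f r)) ∂μ ≠ ⊤) :
    (∀ᵐ r ∂μ, f r ≠ ⊤) ∧ (∀ᵐ r ∂μ, f r ≠ ⊥) ∧ Integrable (fun r => (f r).toReal) μ := by
  have a1 : ∀ᵐ r ∂μ, f r ≠ ⊤ := by
    filter_upwards [ae_lt_top (measurable_ePos.comp hf) h1] with r hr h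
    simp [h, ePos] at hr
  have a2 : ∀ᵐ r ∂μ, f r ≠ ⊥ := by
    filter_upwards [ae_lt_top (measurable_ePos.comp hf.neg) h2] with r hr h
    simp [h, ePos] at hr
  refine ⟨a1, a2, hf.ereal_toReal.aestronglyMeasurable, ?_⟩
  have h3 : ∫⁻ r, (ePos (f r) + ePos (-(f r))) ∂μ < ⊤ := by
    rw [lintegral_add_left (f := fun r => ePos (f r)) (measurable_ePos.comp hf)]
    exact ENNReal.add_lt_top.2 ⟨h1.lt_top, h2.lt_top⟩
  refine lt_of_le_of_lt (lintegral_mono_ae ?_) h3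
  filter_upwards [a1, a2] with r b1 b2
  lift f r to ℝ using ⟨b1, b2⟩ with x
  rw [ePos_coe, ePos_neg_coe, EReal.toReal_coe]
  rcases le_total 0 x with hx | hx
  · rw [Real.enorm_eq_ofReal hx]
    exact le_self_add
  · rw [← enorm_neg, Real.enorm_eq_ofReal (neg_nonneg.2 hx)]
    exact le_add_self

theorem integrable_of_eInt {f : Ω → EReal} (hf : Measurable f)
    (htop : eInt μ f ≠ ⊤) (hbot : eInt μ f ≠ ⊥) :
    (∀ᵐ r ∂μ, f r ≠ ⊤) ∧ (∀ᵐ r ∂μ, f r ≠ ⊥) ∧ Integrable (fun r => (f r).toReal) μ ∧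
      eInt μ f = ((∫ r, (f r).toReal ∂μ : ℝ) : EReal) := by
  obtain ⟨h1, h2⟩ := lintegral_ePos_ne_top_of_eInt htop hbot
  obtain ⟨a1, a2, hi⟩ := integrable_toReal_of_lintegral_ePos hf h1 h2
  exact ⟨a1, a2, hi, eInt_eq_integral_toReal hi a1 a2⟩

end ExtendedIntegral

section Integrand

variable {Ω : Type*} [MeasurableSpace Ω] {μ : Measure Ω} {β : Ω → ℝ → EReal} {β' : Ω → ℝ → ℝ}
  {X : Ω → ℝ} {p₀ : Ω → ℝ} {b₀ : ℝ}

/-- The real-valued version of the integrand `β`. -/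
def realβ (β : Ω → ℝ → EReal) (r : Ω) (s : ℝ) : ℝ := (β r s).toReal

theorem coe_realβ (hst : Standing μ β β' X p₀ b₀) {r : Ω} {s : ℝ} (h : β r s ≠ ⊤) :
    ((realβ β r s : ℝ) : EReal) = β r s :=
  EReal.coe_toReal h (hst.betaNeBot r s)

theorem tendsto_beta_right (hst : Standing μ β β' X p₀ b₀) (r : Ω) {s : ℝ} (hs : 0 ≤ s) :
    Tendsto (β r) (𝓝[>] s) (𝓝 (β r s)) := by
  rcases hs.eq_or_lt with rfl | hs
  · exact hst.betaZero r
  · have h1 : ContinuousAt (fun t => (((β r t).toReal : ℝ) : EReal)) s :=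
      continuous_coe_real_ereal.continuousAt.comp (hst.betaDeriv r s hs).continuousAt
    have h2 : (fun t => (((β r t).toReal : ℝ) : EReal)) =ᶠ[𝓝 s] β r := by
      filter_upwards [lt_mem_nhds hs] with t ht
      exact EReal.coe_toReal (hst.betaFin r t ht) (hst.betaNeBot r t)
    exact ((h1.congr h2).tendsto).mono_left nhdsWithin_le_nhds

theorem measurable_beta_comp (hst : Standing μ β β' X p₀ b₀) {p : Ω → ℝ} (hp : Measurable p)
    (hp0 : ∀ r, 0 ≤ p r) : Measurable (fun r => β r (p r)) := by
  let q : ℕ → Ω → ℝ := fun n r => ((⌊((n : ℝ) + 1) * p r⌋₊ : ℝ) + 1) / ((n : ℝ) + 1)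
  have hn : ∀ n : ℕ, (0 : ℝ) < (n : ℝ) + 1 := fun n => by positivity
  have hlt : ∀ n r, p r < q n r := fun n r => by
    rw [lt_div_iff₀ (hn n), mul_comm]
    exact Nat.lt_floor_add_one _
  have hle : ∀ n r, q n r ≤ p r + 1 / ((n : ℝ) + 1) := fun n r => by
    have e : (p r + 1 / ((n : ℝ) + 1)) * ((n : ℝ) + 1) = ((n : ℝ) + 1) * p r + 1 := by
      have := (hn n).ne'
      field_simp
    rw [div_le_iff₀ (hn n), e]
    have := Nat.floor_le (mul_nonneg (hn n).le (hp0 r))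
    linarith
  refine measurable_of_tendsto_metrizable (f := fun n r => β r (q n r)) (fun n => ?_) ?_
  · have h1 : Measurable (fun x : Ω × ℕ => β x.1 (((x.2 : ℝ) + 1) / ((n : ℝ) + 1))) :=
      measurable_from_prod_countable_left fun m =>
        hst.betaMeas (((m : ℝ) + 1) / ((n : ℝ) + 1))
    exact h1.comp (measurable_id.prodMk (Nat.measurable_floor.comp (measurable_const.mul hp)))
  · refine tendsto_pi_nhds.2 fun r => (tendsto_beta_right hst r (hp0 r)).comp ?_
    refine tendsto_nhdsWithin_iff.2 ⟨?_, Eventually.of_forall fun n => hlt n r⟩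
    refine tendsto_of_tendsto_of_tendsto_of_le_of_le tendsto_const_nhds ?_
      (fun n => (hlt n r).le) (fun n => hle n r)
    simpa using (tendsto_const_nhds (x := p r)).add (tendsto_one_div_add_atTop_nhds_zero_nat (𝕜 := ℝ))

theorem measurable_realβ_comp (hst : Standing μ β β' X p₀ b₀) {p : Ω → ℝ} (hp : Measurable p)
    (hp0 : ∀ r, 0 ≤ p r) : Measurable (fun r => realβ β r (p r)) :=
  (measurable_beta_comp hst hp hp0).ereal_toReal

theorem tendsto_realβ_right (hst : Standing μ β β' X p₀ b₀) {r : Ω} {s : ℝ} (hs : 0 ≤ s)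
    (h : β r s ≠ ⊤) : Tendsto (fun ε => realβ β r (s + ε)) (𝓝[>] 0) (𝓝 (realβ β r s)) := by
  refine (EReal.tendsto_toReal h (hst.betaNeBot r s)).comp
    ((tendsto_beta_right hst r hs).comp ?_)
  refine tendsto_nhdsWithin_iff.2 ⟨?_, ?_⟩
  · have : Tendsto (fun ε : ℝ => s + ε) (𝓝 0) (𝓝 (s + 0)) := tendsto_const_nhds.add tendsto_id
    rw [add_zero] at this
    exact this.mono_left nhdsWithin_le_nhds
  · filter_upwards [self_mem_nhdsWithin] with ε hε
    exact lt_add_of_pos_right s hε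

theorem realβ_convex (hst : Standing μ β β' X p₀ b₀) {r : Ω} {x y : ℝ} (hx : 0 ≤ x) (hy : 0 ≤ y)
    (hbx : β r x ≠ ⊤) (hby : β r y ≠ ⊤) {a b : ℝ} (ha : 0 ≤ a) (hb : 0 ≤ b) (hab : a + b = 1) :
    β r (a * x + b * y) ≠ ⊤ ∧
      realβ β r (a * x + b * y) ≤ a * realβ β r x + b * realβ β r y := by
  have h0 : 0 ≤ a * x + b * y := by positivity
  have hfin : β r (a * x + b * y) ≠ ⊤ := by
    rcases h0.eq_or_lt with h | h
    · have h1 : a * x = 0 := by nlinarith [mul_nonneg ha hx, mul_nonneg hb hy]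
      have h2 : b * y = 0 := by nlinarith [mul_nonneg ha hx, mul_nonneg hb hy]
      rw [← h]
      rcases mul_eq_zero.1 h1 with rfl | rfl
      · have : b = 1 := by linarith
        rw [this, one_mul] at h2
        rwa [h2] at hby
      · exact hbx
    · exact hst.betaFin r _ h
  refine ⟨hfin, ?_⟩
  refine le_of_tendsto_of_tendsto (tendsto_realβ_right hst h0 hfin)
    (((tendsto_realβ_right hst hx hbx).const_mul a).add
      ((tendsto_realβ_right hst hy hby).const_mul b)) ?_
  filter_upwards [self_mem_nhdsWithin] with ε hε
  have hε : 0 < ε := hε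
  have h := (hst.betaConv r).convexOn.2 (x := x + ε) (y := y + ε)
    (by simp only [mem_Ioi]; linarith) (by simp only [mem_Ioi]; linarith) ha hb hab
  have e : a * x + b * y + ε = a • (x + ε) + b • (y + ε) := by
    simp only [smul_eq_mul]
    linear_combination (-ε) * hab
  rw [e]
  simpa [realβ] using h

theorem le_conjβ (hst : Standing μ β β' X p₀ b₀) (r : Ω) (τ : ℝ) {s : ℝ} (h : β r s ≠ ⊤) :
    ((s * τ - realβ β r s : ℝ) : EReal) ≤ conjβ β r τ := by
  rw [EReal.coe_sub, coe_realβ hst h]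
  exact le_iSup (fun s : ℝ => ((s * τ : ℝ) : EReal) - β r s) s

theorem conjβ_ne_bot (hst : Standing μ β β' X p₀ b₀) (r : Ω) (τ : ℝ) : conjβ β r τ ≠ ⊥ := by
  intro h
  have := le_conjβ hst r τ (hst.betaFin r 1 one_pos)
  rw [h, le_bot_iff] at this
  exact EReal.coe_ne_bot _ this

theorem conjβ_eq_iSup_rat (hst : Standing μ β β' X p₀ b₀) (r : Ω) (τ : ℝ) :
    conjβ β r τ = ⨆ q : {q : ℚ // 0 < q}, (((q.1 : ℝ) * τ - realβ β r q.1 : ℝ) : EReal) := by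
  refine le_antisymm (iSup_le fun s => ?_)
    (iSup_le fun q => le_conjβ hst r τ (hst.betaFin r _ (by exact_mod_cast q.2)))
  rcases lt_or_ge s 0 with hs | hs
  · rw [hst.betaNeg r s hs, EReal.sub_top]
    exact bot_le
  · have h1 : Tendsto (fun t : ℝ => ((t * τ : ℝ) : EReal) - β r t) (𝓝[>] s)
        (𝓝 (((s * τ : ℝ) : EReal) - β r s)) := by
      simp only [sub_eq_add_neg]
      have h2 : Tendsto (fun t : ℝ => (((t * τ : ℝ) : EReal), -β r t)) (𝓝[>] s)
          (𝓝 (((s * τ : ℝ) : EReal), -β r s)) := by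
        refine Tendsto.prodMk_nhds ?_ ?_
        · have : Continuous fun t : ℝ => ((t * τ : ℝ) : EReal) :=
            continuous_coe_real_ereal.comp (continuous_id.mul continuous_const)
          exact (this.tendsto s).mono_left nhdsWithin_le_nhds
        · exact (continuous_neg.tendsto _).comp (tendsto_beta_right hst r hs)
      exact (EReal.continuousAt_add (p := (((s * τ : ℝ) : EReal), -β r s))
        (Or.inl (EReal.coe_ne_top _)) (Or.inl (EReal.coe_ne_bot _))).tendsto.comp h2
    refine le_of_forall_lt fun c hc => ?_
    have h3 := h1.eventually (lt_mem_nhds hc)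
    obtain ⟨u, hu, hsub⟩ := (mem_nhdsGT_iff_exists_Ioo_subset).1 h3
    obtain ⟨q, hq1, hq2⟩ := exists_rat_btwn (show s < u from hu)
    have hq0 : (0 : ℝ) < q := lt_of_le_of_lt hs hq1
    refine lt_of_lt_of_le (hsub ⟨hq1, hq2⟩ : c < _) ?_
    rw [← coe_realβ hst (hst.betaFin r q hq0), ← EReal.coe_sub]
    exact le_iSup (fun q : {q : ℚ // 0 < q} =>
      (((q.1 : ℝ) * τ - realβ β r q.1 : ℝ) : EReal)) ⟨q, by exact_mod_cast hq0⟩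

theorem measurable_conjβ_comp (hst : Standing μ β β' X p₀ b₀) {τ : Ω → ℝ} (hτ : Measurable τ) :
    Measurable (fun r => conjβ β r (τ r)) := by
  simp only [fun r => conjβ_eq_iSup_rat hst r (τ r)]
  refine Measurable.iSup fun q => Measurable.coe_real_ereal ?_
  exact (hτ.const_mul _).sub (hst.betaMeas _).ereal_toReal

theorem conjβ_mono (hst : Standing μ β β' X p₀ b₀) (r : Ω) {τ₁ τ₂ : ℝ} (h : τ₁ ≤ τ₂) :
    conjβ β r τ₁ ≤ conjβ β r τ₂ := by
  rw [conjβ_eq_iSup_rat hst, conjβ_eq_iSup_rat hst]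
  refine iSup_mono fun q => EReal.coe_le_coe_iff.2 ?_
  have : (0 : ℝ) ≤ q.1 := by exact_mod_cast q.2.le
  gcongr

end Integrand

section RegularFunctions

variable {Ω : Type*} [MeasurableSpace Ω] {μ : Measure Ω} {β : Ω → ℝ → EReal} {β' : Ω → ℝ → ℝ}
  {X : Ω → ℝ} {p₀ : Ω → ℝ} {b₀ : ℝ}

/-- A nonnegative function for which mass, payoff and `H` are all finite. -/
structure FiniteIntegrals (μ : Measure Ω) (β : Ω → ℝ → EReal) (X p : Ω → ℝ) : Prop where
  meas : Measurable p
  nonneg : ∀ r, 0 ≤ p r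
  fin : ∀ᵐ r ∂μ, β r (p r) ≠ ⊤
  int : Integrable p μ
  intX : Integrable (fun r => X r * p r) μ
  intβ : Integrable (fun r => realβ β r (p r)) μ

theorem isDensity_iff_integral {p : Ω → ℝ} :
    IsDensity μ p ↔ Measurable p ∧ (∀ r, 0 ≤ p r) ∧ Integrable p μ ∧ ∫ r, p r ∂μ = 1 := by
  refine ⟨fun ⟨h1, h2, h3⟩ => ⟨h1, h2, ?_⟩, fun ⟨h1, h2, h3, h4⟩ => ⟨h1, h2, ?_⟩⟩
  · have h4 := integral_eq_lintegral_of_nonneg_ae (μ := μ) (Eventually.of_forall h2)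
      h1.aestronglyMeasurable
    rw [h3, ENNReal.toReal_one] at h4
    exact ⟨.of_integral_ne_zero (by rw [h4]; exact one_ne_zero), h4⟩
  · rw [← ofReal_integral_eq_lintegral_ofReal h3 (Eventually.of_forall h2), h4,
      ENNReal.ofReal_one]

theorem lintegral_ePos_neg_beta_ne_top (hst : Standing μ β β' X p₀ b₀) {p : Ω → ℝ}
    (hp : Measurable p) (hp0 : ∀ r, 0 ≤ p r) (hpi : Integrable p μ) :
    ∫⁻ r, ePos (-(β r (p r))) ∂μ ≠ ⊤ := by
  intro hinf
  have := hst.sigma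
  have hβm := measurable_beta_comp hst hp hp0
  let A : ℕ → Set Ω := fun j => spanningSets μ j ∩ {r | ((-(j : ℝ) : ℝ) : EReal) ≤ β r (p r)}
  have hAm : ∀ j, MeasurableSet (A j) := fun j =>
    (measurableSet_spanningSets μ j).inter (measurableSet_le measurable_const hβm)
  have hmono : Monotone A := fun i j hij r hr =>
    ⟨monotone_spanningSets μ hij hr.1,
      le_trans (EReal.coe_le_coe_iff.2 (neg_le_neg (Nat.cast_le.2 hij))) hr.2⟩
  have hU : ⋃ j, A j = univ := by
    refine eq_univ_of_forall fun r => mem_iUnion.2 ?_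
    obtain ⟨i, hi⟩ := mem_iUnion.1 (iUnion_spanningSets μ ▸ mem_univ r)
    obtain ⟨j, hj⟩ := exists_nat_ge (-(β r (p r)).toReal)
    refine ⟨max i j, monotone_spanningSets μ (le_max_left i j) hi, ?_⟩
    refine le_trans (EReal.coe_le_coe_iff.2 ?_) (EReal.coe_toReal_le (hst.betaNeBot r (p r)))
    have : (j : ℝ) ≤ (max i j : ℕ) := Nat.cast_le.2 (le_max_right i j)
    linarith
  have hI : ⋂ j, (A j)ᶜ = ∅ := by rw [← compl_iUnion, hU, compl_univ]
  obtain ⟨-, hn0, hi0, hI0⟩ := isDensity_iff_integral.1 hst.dens₀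
  have t1 : Tendsto (fun j => ∫ r in A j, p₀ r ∂μ) atTop (𝓝 1) := by
    have := tendsto_setIntegral_of_monotone hAm hmono hi0.integrableOn
    rwa [hU, setIntegral_univ, hI0] at this
  have t2 : Tendsto (fun j => ∫ r in (A j)ᶜ, p r ∂μ) atTop (𝓝 0) := by
    have := tendsto_setIntegral_of_antitone (s := fun j => (A j)ᶜ) (fun j => (hAm j).compl)
      (fun i j hij => compl_subset_compl.2 (hmono hij)) ⟨0, hpi.integrableOn⟩
    rwa [hI, setIntegral_empty] at this
  obtain ⟨j, hj1, hj2⟩ := ((t1.eventually (lt_mem_nhds one_pos)).and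
    (t2.eventually (gt_mem_nhds one_pos))).exists
  set c := (1 - ∫ r in (A j)ᶜ, p r ∂μ) / ∫ r in A j, p₀ r ∂μ with hc
  have hc0 : 0 ≤ c := div_nonneg (by linarith) hj1.le
  classical
  let q := (A j).piecewise (fun r => c * p₀ r) p
  have hq : IsDensity μ q := by
    refine isDensity_iff_integral.2 ⟨(measurable_const.mul hst.dens₀.1).piecewise (hAm j) hp,
      fun r => ?_, Integrable.piecewise (hAm j) (hi0.const_mul c).integrableOn hpi.integrableOn, ?_⟩
    · by_cases hr : r ∈ A j
      · simpa only [q, piecewise_eq_of_mem _ _ _ hr] using mul_nonneg hc0 (hn0 r)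
      · simpa only [q, piecewise_eq_of_notMem _ _ _ hr] using hp0 r
    · rw [integral_piecewise (hAm j) (hi0.const_mul c).integrableOn hpi.integrableOn,
        integral_const_mul, hc, div_mul_cancel₀ _ hj1.ne']
      ring
  have hfin : ∫⁻ r in A j, ePos (-(β r (p r))) ∂μ ≠ ⊤ := by
    have : ∫⁻ r in A j, ePos (-(β r (p r))) ∂μ ≤ ∫⁻ r in A j, (j : ℝ≥0∞) ∂μ := by
      refine setLIntegral_mono' (hAm j) fun r hr => ?_
      have h1 : -(β r (p r)) ≤ ((j : ℝ) : EReal) := by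
        rw [EReal.neg_le, ← EReal.coe_neg]
        exact hr.2
      have h2 := ePos_mono h1
      rwa [ePos_coe, ENNReal.ofReal_natCast] at h2
    refine ne_top_of_le_ne_top ?_ this
    rw [setLIntegral_const]
    exact ENNReal.mul_ne_top (ENNReal.natCast_ne_top j)
      ((measure_mono inter_subset_left).trans_lt (measure_spanningSets_lt_top μ j)).ne
  have hbad : ∫⁻ r in (A j)ᶜ, ePos (-(β r (p r))) ∂μ = ⊤ := by
    rw [← lintegral_add_compl _ (hAm j)] at hinf
    exact (ENNReal.add_eq_top.1 hinf).resolve_left hfin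
  have hbad' : ∫⁻ r, ePos (-(β r (q r))) ∂μ = ⊤ := by
    refine top_le_iff.1 (hbad ▸ le_trans (le_of_eq ?_) (setLIntegral_le_lintegral (A j)ᶜ _))
    refine setLIntegral_congr_fun (hAm j).compl fun r hr => ?_
    simp only [q, piecewise_eq_of_notMem _ _ _ hr]
  have := hst.Hnonneg q hq
  rw [Hfun, eInt, hbad', EReal.coe_ennreal_top, EReal.sub_top] at this
  exact absurd this (by simp)

theorem FiniteIntegrals.of_Hfun_le (hst : Standing μ β β' X p₀ b₀) {p : Ω → ℝ} (hp : IsDensity μ p)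
    {k : ℝ} (hH : Hfun μ β p ≤ k) (htop : xInt μ X p ≠ ⊤) (hbot : xInt μ X p ≠ ⊥) :
    FiniteIntegrals μ β X p ∧ ∫ r, p r ∂μ = 1 ∧ Hfun μ β p = ((∫ r, realβ β r (p r) ∂μ : ℝ) : EReal) ∧
      xInt μ X p = ((∫ r, X r * p r ∂μ : ℝ) : EReal) := by
  obtain ⟨h1, h2, h3, h4⟩ := isDensity_iff_integral.1 hp
  obtain ⟨c1, -, c3, c4⟩ := integrable_of_eInt (measurable_beta_comp hst h1 h2)
    (ne_top_of_le_ne_top (EReal.coe_ne_top k) hH)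
    (ne_bot_of_le_ne_bot EReal.zero_ne_bot (hst.Hnonneg p hp))
  obtain ⟨-, -, d3, d4⟩ := integrable_of_eInt (f := fun r => ((X r * p r : ℝ) : EReal))
    (hst.Xmeas.mul h1).coe_real_ereal htop hbot
  exact ⟨⟨h1, h2, c1, h3, d3, c3⟩, h4, c4, d4⟩

theorem FiniteIntegrals.reference (hst : Standing μ β β' X p₀ b₀) :
    FiniteIntegrals μ β X p₀ ∧ ∫ r, p₀ r ∂μ = 1 ∧ ∫ r, realβ β r (p₀ r) ∂μ = 0 ∧
      ∫ r, X r * p₀ r ∂μ = b₀ := by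
  obtain ⟨h1, h2, h3, h4⟩ := FiniteIntegrals.of_Hfun_le hst hst.dens₀ (k := 0)
    (by rw [hst.H₀, EReal.coe_zero])
    (by rw [hst.payoff₀]; exact EReal.coe_ne_top _) (by rw [hst.payoff₀]; exact EReal.coe_ne_bot _)
  rw [hst.H₀] at h3
  rw [hst.payoff₀] at h4
  exact ⟨h1, h2, by exact_mod_cast h3.symm, by exact_mod_cast h4.symm⟩

theorem FiniteIntegrals.Hfun_eq (hst : Standing μ β β' X p₀ b₀) {p : Ω → ℝ} (hp : FiniteIntegrals μ β X p) :
    Hfun μ β p = ((∫ r, realβ β r (p r) ∂μ : ℝ) : EReal) :=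
  eInt_eq_integral_toReal hp.intβ hp.fin (Eventually.of_forall fun r => hst.betaNeBot r _)

theorem FiniteIntegrals.mix (hst : Standing μ β β' X p₀ b₀) {p q : Ω → ℝ} (hp : FiniteIntegrals μ β X p)
    (hq : FiniteIntegrals μ β X q) {a b : ℝ} (ha : 0 ≤ a) (hb : 0 ≤ b) (hab : a + b = 1) :
    FiniteIntegrals μ β X (fun r => a * p r + b * q r) ∧
      ∫ r, realβ β r (a * p r + b * q r) ∂μ ≤
        a * ∫ r, realβ β r (p r) ∂μ + b * ∫ r, realβ β r (q r) ∂μ := by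
  have hm : Measurable (fun r => a * p r + b * q r) := (hp.meas.const_mul a).add (hq.meas.const_mul b)
  have h0 : ∀ r, 0 ≤ a * p r + b * q r := fun r =>
    add_nonneg (mul_nonneg ha (hp.nonneg r)) (mul_nonneg hb (hq.nonneg r))
  have hi : Integrable (fun r => a * p r + b * q r) μ := (hp.int.const_mul a).add (hq.int.const_mul b)
  have hcv : ∀ᵐ r ∂μ, β r (a * p r + b * q r) ≠ ⊤ ∧ realβ β r (a * p r + b * q r) ≤
      a * realβ β r (p r) + b * realβ β r (q r) := by
    filter_upwards [hp.fin, hq.fin] with r h1 h2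
    exact realβ_convex hst (hp.nonneg r) (hq.nonneg r) h1 h2 ha hb hab
  have hri : Integrable (fun r => a * realβ β r (p r) + b * realβ β r (q r)) μ :=
    (hp.intβ.const_mul a).add (hq.intβ.const_mul b)
  have hpos : ∫⁻ r, ePos (β r (a * p r + b * q r)) ∂μ ≠ ⊤ := by
    refine ne_top_of_le_ne_top hri.lintegral_lt_top.ne (lintegral_mono_ae ?_)
    filter_upwards [hcv] with r hr
    rw [← coe_realβ hst hr.1, ePos_coe]
    exact ENNReal.ofReal_le_ofReal hr.2
  obtain ⟨c1, -, c3⟩ := integrable_toReal_of_lintegral_ePos (measurable_beta_comp hst hm h0) hpos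
    (lintegral_ePos_neg_beta_ne_top hst hm h0 hi)
  refine ⟨⟨hm, h0, c1, hi, ?_, c3⟩, ?_⟩
  · refine ((hp.intX.const_mul a).add (hq.intX.const_mul b)).congr (Eventually.of_forall fun r => ?_)
    simp only [Pi.add_apply]
    ring
  · calc ∫ r, realβ β r (a * p r + b * q r) ∂μ
        ≤ ∫ r, (a * realβ β r (p r) + b * realβ β r (q r)) ∂μ :=
          integral_mono_ae c3 hri (hcv.mono fun r hr => hr.2)
      _ = _ := by
          rw [integral_add (hp.intβ.const_mul a) (hq.intβ.const_mul b), integral_const_mul,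
            integral_const_mul]

theorem integral_mul_mix {p q : Ω → ℝ} {f : Ω → ℝ} (hp : Integrable (fun r => f r * p r) μ)
    (hq : Integrable (fun r => f r * q r) μ) (a b : ℝ) :
    ∫ r, f r * (a * p r + b * q r) ∂μ = a * ∫ r, f r * p r ∂μ + b * ∫ r, f r * q r ∂μ := by
  rw [← integral_const_mul, ← integral_const_mul,
    ← integral_add (hp.const_mul a) (hq.const_mul b)]
  congr 1 with r
  ring

/-- The sets on which the function `q` can safely replace any other regular function. -/
def cutSet (μ : Measure Ω) [SigmaFinite μ] (β : Ω → ℝ → EReal) (X q : Ω → ℝ) (j : ℕ) : Set Ω :=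
  spanningSets μ j ∩ {r | |X r| ≤ j ∧ q r ≤ j ∧ |realβ β r (q r)| ≤ j}

theorem monotone_cutSet [SigmaFinite μ] (q : Ω → ℝ) : Monotone (cutSet μ β X q) :=
  fun _ _ hij _ hr =>
    have h := Nat.cast_le (α := ℝ).2 hij
    ⟨monotone_spanningSets μ hij hr.1, hr.2.1.trans h, hr.2.2.1.trans h, hr.2.2.2.trans h⟩

theorem iUnion_cutSet [SigmaFinite μ] (q : Ω → ℝ) : ⋃ j, cutSet μ β X q j = univ := by
  refine eq_univ_of_forall fun r => mem_iUnion.2 ?_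
  obtain ⟨i, hi⟩ := mem_iUnion.1 (iUnion_spanningSets μ ▸ mem_univ r)
  obtain ⟨j, hj⟩ := exists_nat_ge (max (|X r|) (max (q r) |realβ β r (q r)|))
  have hj' : (j : ℝ) ≤ (max i j : ℕ) := Nat.cast_le.2 (le_max_right i j)
  refine ⟨max i j, monotone_spanningSets μ (le_max_left i j) hi, ?_⟩
  have h := hj.trans hj'
  exact ⟨(le_max_left _ _).trans h, ((le_max_left _ _).trans (le_max_right _ _)).trans h,
    ((le_max_right _ _).trans (le_max_right _ _)).trans h⟩

theorem measurableSet_cutSet [SigmaFinite μ] (hst : Standing μ β β' X p₀ b₀) {q : Ω → ℝ}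
    (hq : Measurable q) (hq0 : ∀ r, 0 ≤ q r) (j : ℕ) : MeasurableSet (cutSet μ β X q j) :=
  (measurableSet_spanningSets μ j).inter <|
    (measurableSet_le hst.Xmeas.abs measurable_const).inter <|
      (measurableSet_le hq measurable_const).inter
        (measurableSet_le (measurable_realβ_comp hst hq hq0).abs measurable_const)

theorem measure_cutSet_lt_top [SigmaFinite μ] (q : Ω → ℝ) (j : ℕ) :
    μ (cutSet μ β X q j) < ⊤ :=
  (measure_mono inter_subset_left).trans_lt (measure_spanningSets_lt_top μ j)

theorem integrableOn_cutSet [SigmaFinite μ] (hst : Standing μ β β' X p₀ b₀) {q : Ω → ℝ}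
    (hq : Measurable q) (hq0 : ∀ r, 0 ≤ q r) (j : ℕ) :
    IntegrableOn q (cutSet μ β X q j) μ ∧ IntegrableOn (fun r => X r * q r) (cutSet μ β X q j) μ ∧
      IntegrableOn (fun r => realβ β r (q r)) (cutSet μ β X q j) μ := by
  have hm := measurableSet_cutSet (μ := μ) hst hq hq0 j
  have hf := (measure_cutSet_lt_top (μ := μ) (β := β) (X := X) q j).ne
  refine ⟨Measure.integrableOn_of_bounded (M := j) hf hq.aestronglyMeasurable ?_,
    Measure.integrableOn_of_bounded (M := j * j) hf (hst.Xmeas.mul hq).aestronglyMeasurable ?_,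
    Measure.integrableOn_of_bounded (M := j) hf
      (measurable_realβ_comp hst hq hq0).aestronglyMeasurable ?_⟩
  all_goals
    filter_upwards [ae_restrict_mem hm] with r hr
  · rw [Real.norm_of_nonneg (hq0 r)]
    exact hr.2.2.1
  · rw [norm_mul, Real.norm_of_nonneg (hq0 r)]
    exact mul_le_mul hr.2.1 hr.2.2.1 (hq0 r) (Nat.cast_nonneg j)
  · exact hr.2.2.2

open Classical in
theorem FiniteIntegrals.piecewise_cutSet [SigmaFinite μ] (hst : Standing μ β β' X p₀ b₀) {p q : Ω → ℝ}
    (hp : FiniteIntegrals μ β X p) (hq : Measurable q) (hq0 : ∀ r, 0 ≤ q r)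
    (hqf : ∀ᵐ r ∂μ, β r (q r) ≠ ⊤) (j : ℕ) :
    FiniteIntegrals μ β X ((cutSet μ β X q j).piecewise q p) := by
  have hm := measurableSet_cutSet (μ := μ) hst hq hq0 j
  obtain ⟨h1, h2, h3⟩ := integrableOn_cutSet (μ := μ) hst hq hq0 j
  refine ⟨hq.piecewise hm hp.meas, fun r => ?_, ?_, Integrable.piecewise hm h1 hp.int.integrableOn,
    (Integrable.piecewise hm h2 hp.intX.integrableOn).congr (Eventually.of_forall fun r => ?_),
    (Integrable.piecewise hm h3 hp.intβ.integrableOn).congr (Eventually.of_forall fun r => ?_)⟩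
  · by_cases hr : r ∈ cutSet μ β X q j
    · simpa [hr] using hq0 r
    · simpa [hr] using hp.nonneg r
  · filter_upwards [hqf, hp.fin] with r a1 a2
    by_cases hr : r ∈ cutSet μ β X q j
    · simpa [hr] using a1
    · simpa [hr] using a2
  all_goals
    by_cases hr : r ∈ cutSet μ β X q j <;> simp [hr]

end RegularFunctions

/-- A convex subset of the plane that lies above the level `c` on the vertical line over `a`, and
reaches strictly to both sides of this line, lies above some line through `(a, c)`. -/
theorem exists_supporting_slope {S : Set (ℝ × ℝ)} (hS : Convex ℝ S) {a c : ℝ}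
    (hc : ∀ h, (a, h) ∈ S → c ≤ h) (hl : ∃ x ∈ S, x.1 < a) (hr : ∃ x ∈ S, a < x.1) :
    ∃ θ : ℝ, ∀ x ∈ S, c + θ * (x.1 - a) ≤ x.2 := by
  have key : ∀ l ∈ S, ∀ r ∈ S, l.1 < a → a < r.1 →
      (l.2 - c) / (l.1 - a) ≤ (r.2 - c) / (r.1 - a) := by
    intro l hlS r hrS hla har
    have hd : 0 < r.1 - l.1 := by linarith
    have hmem := hS hlS hrS (a := (r.1 - a) / (r.1 - l.1)) (b := (a - l.1) / (r.1 - l.1))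
      (div_nonneg (by linarith) hd.le) (div_nonneg (by linarith) hd.le) (by field_simp; ring)
    have he : ((r.1 - a) / (r.1 - l.1)) • l + ((a - l.1) / (r.1 - l.1)) • r =
        (a, ((r.1 - a) * l.2 + (a - l.1) * r.2) / (r.1 - l.1)) := by
      refine Prod.ext ?_ ?_
      · simp only [Prod.fst_add, Prod.smul_fst, smul_eq_mul]
        field_simp
        ring
      · simp only [Prod.snd_add, Prod.smul_snd, smul_eq_mul]
        field_simp
    rw [he] at hmem
    have h1 := hc _ hmem
    rw [le_div_iff₀ hd] at h1
    rw [← neg_div_neg_eq, div_le_div_iff₀ (by linarith) (by linarith)]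
    nlinarith
  obtain ⟨l₀, hl₀, hl₀a⟩ := hl
  obtain ⟨r₀, hr₀, hr₀a⟩ := hr
  let T : Set ℝ := {t | ∃ x ∈ S, a < x.1 ∧ t = (x.2 - c) / (x.1 - a)}
  have hTne : T.Nonempty := ⟨_, r₀, hr₀, hr₀a, rfl⟩
  have hTlow : ∀ l ∈ S, l.1 < a → ∀ t ∈ T, (l.2 - c) / (l.1 - a) ≤ t := by
    rintro l hlS hla t ⟨x, hx, hxa, rfl⟩
    exact key l hlS x hx hla hxa
  refine ⟨sInf T, fun x hx => ?_⟩
  rcases lt_trichotomy x.1 a with h | h | h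
  · have h1 : (x.2 - c) / (x.1 - a) ≤ sInf T := le_csInf hTne (hTlow x hx h)
    rw [div_le_iff_of_neg (by linarith)] at h1
    linarith
  · have := hc x.2 (by rw [← h]; exact hx)
    rw [h, sub_self, mul_zero, add_zero]
    exact this
  · have h1 : sInf T ≤ (x.2 - c) / (x.1 - a) :=
      csInf_le ⟨_, hTlow l₀ hl₀ hl₀a⟩ ⟨x, hx, h, rfl⟩
    rw [le_div_iff₀ (by linarith)] at h1
    linarith

/-- Successive pointwise minimisation of `g` over the start value `p` and the constants `e n`. -/
noncomputable def greedySeq {Ω : Type*} (g : Ω → ℝ → ℝ) (e : ℕ → ℝ) (p : Ω → ℝ) : ℕ → Ω → ℝ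
  | 0 => p
  | n + 1 => fun r => if g r (e n) < g r (greedySeq g e p n r) then e n else greedySeq g e p n r

theorem greedySeq_succ_le {Ω : Type*} (g : Ω → ℝ → ℝ) (e : ℕ → ℝ) (p : Ω → ℝ) (n : ℕ) (r : Ω) :
    g r (greedySeq g e p (n + 1) r) ≤ g r (greedySeq g e p n r) ∧
      g r (greedySeq g e p (n + 1) r) ≤ g r (e n) := by
  simp only [greedySeq]
  split_ifs with h
  · exact ⟨h.le, le_rfl⟩
  · exact ⟨le_rfl, not_lt.1 h⟩

section Duality

variable {Ω : Type*} [MeasurableSpace Ω] {μ : Measure Ω} {β : Ω → ℝ → EReal} {β' : Ω → ℝ → ℝ}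
  {X : Ω → ℝ} {p₀ : Ω → ℝ} {b₀ : ℝ}

theorem exists_finiteIntegrals_mass_mem (hst : Standing μ β β' X p₀ b₀) {t : ℝ} (ht : 0 < t)
    {U : Set ℝ} (hU : U ∈ 𝓝 t) : ∃ p, FiniteIntegrals μ β X p ∧ ∫ r, p r ∂μ ∈ U := by
  classical
  have := hst.sigma
  obtain ⟨hg, hg1, -, -⟩ := FiniteIntegrals.reference hst
  let q : Ω → ℝ := fun r => t * p₀ r
  have hq : Measurable q := hg.meas.const_mul t
  have hq0 : ∀ r, 0 ≤ q r := fun r => mul_nonneg ht.le (hg.nonneg r)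
  have hqi : Integrable q μ := hg.int.const_mul t
  have hqf : ∀ᵐ r ∂μ, β r (q r) ≠ ⊤ := by
    filter_upwards [hg.fin] with r hr
    rcases (hg.nonneg r).eq_or_lt with h | h
    · simpa [q, ← h] using hr
    · exact hst.betaFin r _ (mul_pos ht h)
  have hm := measurableSet_cutSet (μ := μ) (X := X) hst hq hq0
  have t1 := tendsto_setIntegral_of_monotone hm (monotone_cutSet (μ := μ) q) hqi.integrableOn
  have t2 := tendsto_setIntegral_of_antitone (s := fun j => (cutSet μ β X q j)ᶜ)
    (fun j => (hm j).compl) (fun i j hij => compl_subset_compl.2 (monotone_cutSet q hij))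
    ⟨0, hg.int.integrableOn⟩
  rw [iUnion_cutSet, setIntegral_univ, integral_const_mul, hg1, mul_one] at t1
  rw [← compl_iUnion, iUnion_cutSet, compl_univ, setIntegral_empty] at t2
  have t3 := t1.add t2
  rw [add_zero] at t3
  obtain ⟨j, hj⟩ := (t3.eventually hU).exists
  refine ⟨_, hg.piecewise_cutSet hst hq hq0 hqf j, ?_⟩
  rwa [integral_piecewise (hm j) hqi.integrableOn hg.int.integrableOn]

theorem exists_mass_multiplier (hst : Standing μ β β' X p₀ b₀) {lam c : ℝ} (hlam : 0 ≤ lam)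
    (h : ∀ p, FiniteIntegrals μ β X p → ∫ r, p r ∂μ = 1 →
      c ≤ ∫ r, X r * p r ∂μ + lam * ∫ r, realβ β r (p r) ∂μ) :
    ∃ θ : ℝ, ∀ p, FiniteIntegrals μ β X p →
      c + θ * (∫ r, p r ∂μ - 1) ≤ ∫ r, X r * p r ∂μ + lam * ∫ r, realβ β r (p r) ∂μ := by
  let S : Set (ℝ × ℝ) := {x | ∃ p, FiniteIntegrals μ β X p ∧ ∫ r, p r ∂μ = x.1 ∧
    ∫ r, X r * p r ∂μ + lam * ∫ r, realβ β r (p r) ∂μ ≤ x.2}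
  have hS : Convex ℝ S := by
    rintro x ⟨p, hp, hp1, hp2⟩ y ⟨q, hq, hq1, hq2⟩ a b ha hb hab
    obtain ⟨hm, hle⟩ := hp.mix hst hq ha hb hab
    refine ⟨_, hm, ?_, ?_⟩
    · simp only [Prod.fst_add, Prod.smul_fst, smul_eq_mul]
      rw [integral_add (hp.int.const_mul a) (hq.int.const_mul b), integral_const_mul,
        integral_const_mul, hp1, hq1]
    · simp only [Prod.snd_add, Prod.smul_snd, smul_eq_mul]
      rw [integral_mul_mix hp.intX hq.intX]
      nlinarith [mul_le_mul_of_nonneg_left hle hlam, mul_le_mul_of_nonneg_left hp2 ha,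
        mul_le_mul_of_nonneg_left hq2 hb]
  obtain ⟨p, hp, hp1⟩ := exists_finiteIntegrals_mass_mem hst (t := 1 / 2) (by norm_num)
    (Iio_mem_nhds (by norm_num : (1 / 2 : ℝ) < 1))
  obtain ⟨q, hq, hq1⟩ := exists_finiteIntegrals_mass_mem hst (t := 2) (by norm_num)
    (Ioi_mem_nhds (by norm_num : (1 : ℝ) < 2))
  obtain ⟨θ, hθ⟩ := exists_supporting_slope hS (a := 1) (c := c)
    (fun y ⟨p, hp, hp1, hp2⟩ => (h p hp hp1).trans hp2)
    ⟨(_, _), ⟨p, hp, rfl, le_rfl⟩, hp1⟩ ⟨(_, _), ⟨q, hq, rfl, le_rfl⟩, hq1⟩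
  exact ⟨θ, fun p hp => hθ (_, _) ⟨p, hp, rfl, le_rfl⟩⟩

/-- The pointwise Lagrangian of payoff plus `lam` times divergence minus `θ` times mass. -/
def lagrangian (β : Ω → ℝ → EReal) (X : Ω → ℝ) (lam θ : ℝ) (r : Ω) (s : ℝ) : ℝ :=
  (X r - θ) * s + lam * realβ β r s

theorem FiniteIntegrals.integral_lagrangian {p : Ω → ℝ} (hp : FiniteIntegrals μ β X p)
    (lam θ : ℝ) : Integrable (fun r => lagrangian β X lam θ r (p r)) μ ∧
      ∫ r, lagrangian β X lam θ r (p r) ∂μ =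
        ∫ r, X r * p r ∂μ + lam * ∫ r, realβ β r (p r) ∂μ - θ * ∫ r, p r ∂μ := by
  have he : (fun r => lagrangian β X lam θ r (p r)) =
      fun r => (X r * p r + lam * realβ β r (p r)) - θ * p r := by
    ext r
    rw [lagrangian]
    ring
  have h1 : Integrable (fun r => X r * p r + lam * realβ β r (p r)) μ :=
    hp.intX.add (hp.intβ.const_mul lam)
  rw [he]
  refine ⟨h1.sub (hp.int.const_mul θ), ?_⟩
  rw [integral_sub h1 (hp.int.const_mul θ), integral_add hp.intX (hp.intβ.const_mul lam),
    integral_const_mul, integral_const_mul]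

theorem measurable_lagrangian_comp (hst : Standing μ β β' X p₀ b₀) {p : Ω → ℝ} (hp : Measurable p)
    (hp0 : ∀ r, 0 ≤ p r) (lam θ : ℝ) : Measurable (fun r => lagrangian β X lam θ r (p r)) :=
  ((hst.Xmeas.sub measurable_const).mul hp).add
    ((measurable_realβ_comp hst hp hp0).const_mul lam)

theorem lintegral_lagrangian_sub_le (hst : Standing μ β β' X p₀ b₀) {lam θ c : ℝ}
    (h : ∀ p, FiniteIntegrals μ β X p → c ≤ ∫ r, lagrangian β X lam θ r (p r) ∂μ)
    {p q : Ω → ℝ} (hp : FiniteIntegrals μ β X p) (hq : Measurable q) (hq0 : ∀ r, 0 ≤ q r)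
    (hqf : ∀ᵐ r ∂μ, β r (q r) ≠ ⊤)
    (hle : ∀ᵐ r ∂μ, lagrangian β X lam θ r (q r) ≤ lagrangian β X lam θ r (p r)) :
    ∫⁻ r, ENNReal.ofReal (lagrangian β X lam θ r (p r) - lagrangian β X lam θ r (q r)) ∂μ ≤
      ENNReal.ofReal (∫ r, lagrangian β X lam θ r (p r) ∂μ - c) := by
  classical
  have := hst.sigma
  have hm := measurableSet_cutSet (μ := μ) (X := X) hst hq hq0
  rw [← setLIntegral_univ, ← iUnion_cutSet (μ := μ) (β := β) (X := X) q,
    setLIntegral_iUnion_of_directed _ (monotone_cutSet q).directed_le]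
  refine iSup_le fun j => ?_
  obtain ⟨i1, i2, i3⟩ := integrableOn_cutSet (μ := μ) hst hq hq0 j
  have hpi := (hp.integral_lagrangian lam θ).1
  have hqi : IntegrableOn (fun r => lagrangian β X lam θ r (q r)) (cutSet μ β X q j) μ := by
    refine IntegrableOn.congr_fun ((i2.sub (i1.const_mul θ)).add (i3.const_mul lam))
      (fun r _ => ?_) (hm j)
    simp only [lagrangian, Pi.add_apply, Pi.sub_apply]
    ring
  rw [← ofReal_integral_eq_lintegral_ofReal
    (f := fun r => lagrangian β X lam θ r (p r) - lagrangian β X lam θ r (q r))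
    (hpi.integrableOn.sub hqi)
    ((ae_restrict_of_ae hle).mono fun r hr => sub_nonneg.2 hr)]
  refine ENNReal.ofReal_le_ofReal ?_
  have h1 := h _ (hp.piecewise_cutSet hst hq hq0 hqf j)
  have h2 : ∀ r, lagrangian β X lam θ r ((cutSet μ β X q j).piecewise q p r) =
      (cutSet μ β X q j).piecewise (fun r => lagrangian β X lam θ r (q r))
        (fun r => lagrangian β X lam θ r (p r)) r := fun r => by
    by_cases hr : r ∈ cutSet μ β X q j <;> simp [hr]
  simp only [h2] at h1
  rw [integral_piecewise (hm j) hqi hpi.integrableOn] at h1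
  rw [integral_sub hpi.integrableOn hqi, ← integral_add_compl (hm j) hpi]
  linarith

theorem le_essInfX_of_forall_le (hst : Standing μ β β' X p₀ b₀) {b : ℝ}
    (h : ∀ p, FiniteIntegrals μ β X p → ∫ r, p r ∂μ = 1 → b ≤ ∫ r, X r * p r ∂μ) :
    (b : EReal) ≤ essInfX μ X := by
  classical
  obtain ⟨θ, hθ⟩ := exists_mass_multiplier hst (lam := 0) (c := b) le_rfl
    (fun p hp hp1 => by simpa using h p hp hp1)
  have hL : ∀ p, FiniteIntegrals μ β X p → b - θ ≤ ∫ r, lagrangian β X 0 θ r (p r) ∂μ :=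
    fun p hp => by
      rw [(hp.integral_lagrangian 0 θ).2]
      linarith [hθ p hp]
  obtain ⟨hg, hg1, -, hg3⟩ := FiniteIntegrals.reference hst
  obtain ⟨hgi, hgI⟩ := hg.integral_lagrangian 0 θ
  have hgI' : ∫ r, lagrangian β X 0 θ r (p₀ r) ∂μ = b₀ - θ := by
    rw [hgI, hg1, hg3]
    ring
  have hXθ : ∀ᵐ r ∂μ, θ ≤ X r := by
    have hmeas : Measurable fun r => ENNReal.ofReal (θ - X r) :=
      (measurable_const.sub hst.Xmeas).ennreal_ofReal
    have hbound : ∀ n : ℕ, (n : ℝ≥0∞) * ∫⁻ r, ENNReal.ofReal (θ - X r) ∂μ ≤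
        ENNReal.ofReal (b₀ - b) := by
      intro n
      let q : Ω → ℝ := fun r => p₀ r + if X r < θ then (n : ℝ) else 0
      have hq0 : ∀ r, 0 ≤ q r := fun r => by
        have := hg.nonneg r
        simp only [q]
        split_ifs <;> positivity
      have hqm : Measurable q := hg.meas.add
        (Measurable.ite (measurableSet_lt hst.Xmeas measurable_const) measurable_const
          measurable_const)
      have hdiff : ∀ r, lagrangian β X 0 θ r (p₀ r) - lagrangian β X 0 θ r (q r) =
          if X r < θ then (n : ℝ) * (θ - X r) else 0 := fun r => by
        simp only [lagrangian, q]
        split_ifs <;> ring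
      have := lintegral_lagrangian_sub_le hst hL hg hqm hq0 ?_ ?_
      · rw [hgI', sub_sub_sub_cancel_right] at this
        rw [← lintegral_const_mul _ hmeas]
        refine le_trans (lintegral_mono fun r => ?_) this
        rw [hdiff]
        split_ifs with hr
        · rw [ENNReal.ofReal_mul (Nat.cast_nonneg n), ENNReal.ofReal_natCast]
        · rw [ENNReal.ofReal_of_nonpos (by linarith), mul_zero]
          exact zero_le
      · filter_upwards [hg.fin] with r hr
        rcases (hq0 r).eq_or_lt with h0 | h0
        · have h1 : q r = p₀ r := by
            refine le_antisymm (h0 ▸ hg.nonneg r) (le_add_of_nonneg_right ?_)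
            split_ifs <;> positivity
          rwa [h1]
        · exact hst.betaFin r _ h0
      · refine Eventually.of_forall fun r => sub_nonneg.1 ?_
        rw [hdiff]
        split_ifs with hr
        · exact mul_nonneg (Nat.cast_nonneg n) (by linarith)
        · exact le_rfl
    have hzero : ∫⁻ r, ENNReal.ofReal (θ - X r) ∂μ = 0 := by
      by_contra hne
      obtain ⟨n, hn⟩ := ENNReal.exists_nat_mul_gt hne
        (ENNReal.ofReal_ne_top (r := b₀ - b))
      exact absurd (hbound n) (not_le.2 hn)
    filter_upwards [(lintegral_eq_zero_iff hmeas).1 hzero] with r hr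
    exact sub_nonpos.1 (ENNReal.ofReal_eq_zero.1 hr)
  have hbθ : b ≤ θ := by
    have hnn : ∀ᵐ r ∂μ, 0 ≤ lagrangian β X 0 θ r (p₀ r) := by
      filter_upwards [hXθ] with r hr
      simpa [lagrangian] using mul_nonneg (sub_nonneg.2 hr) (hg.nonneg r)
    have h0 : 0 ≤ b₀ - θ := hgI' ▸ integral_nonneg_of_ae hnn
    have hb₀ : b ≤ b₀ := hg3 ▸ h p₀ hg hg1
    refine le_of_forall_pos_le_add fun δ hδ => ?_
    set ε : ℝ := δ / (b₀ - θ + δ) with hεdef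
    have hε : 0 < ε := by positivity
    have hε1 : ε ≤ 1 := (div_le_one (by positivity)).2 (by linarith)
    have hεδ : ε * (b₀ - θ) ≤ δ := by
      rw [hεdef, div_mul_eq_mul_div, div_le_iff₀ (by positivity)]
      nlinarith
    have hdiff : ∀ r, lagrangian β X 0 θ r (p₀ r) - lagrangian β X 0 θ r (ε * p₀ r) =
        (1 - ε) * lagrangian β X 0 θ r (p₀ r) := fun r => by
      simp only [lagrangian]
      ring
    have hle := lintegral_lagrangian_sub_le hst hL hg (hg.meas.const_mul ε)
      (fun r => mul_nonneg hε.le (hg.nonneg r)) ?_ ?_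
    · simp only [hdiff] at hle
      rw [← ofReal_integral_eq_lintegral_ofReal (hgi.const_mul _)
        (hnn.mono fun r hr => mul_nonneg (by linarith) hr), integral_const_mul, hgI',
        ENNReal.ofReal_le_ofReal_iff (by linarith)] at hle
      linarith
    · filter_upwards [hg.fin] with r hr
      rcases (hg.nonneg r).eq_or_lt with h | h
      · simpa [← h] using hr
      · exact hst.betaFin r _ (mul_pos hε h)
    · filter_upwards [hnn] with r hr
      rw [← sub_nonneg, hdiff]
      exact mul_nonneg (by linarith) hr
  refine le_essInf_of_ae_le _ ?_
  filter_upwards [hXθ] with r hr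
  exact EReal.coe_le_coe_iff.2 (hbθ.trans hr)

theorem Kfun_le_of_forall_le (hst : Standing μ β β' X p₀ b₀) {lam θ c : ℝ} (hlam : 0 < lam)
    (h : ∀ p, FiniteIntegrals μ β X p → c ≤ ∫ r, lagrangian β X lam θ r (p r) ∂μ) :
    Kfun μ β X (θ / lam) (-(1 / lam)) ≤ ((-c / lam : ℝ) : EReal) := by
  obtain ⟨hg, hg1, -, hg3⟩ := FiniteIntegrals.reference hst
  have hgi := (hg.integral_lagrangian lam θ).1
  obtain ⟨e, he⟩ := exists_surjective_nat {q : ℚ // 0 < q}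
  have he0 : ∀ n, (0 : ℝ) < (e n).1 := fun n => by exact_mod_cast (e n).2
  let q := greedySeq (lagrangian β X lam θ) (fun n => ((e n).1 : ℝ)) p₀
  have hq : ∀ n, Measurable (q n) ∧ (∀ r, 0 ≤ q n r) ∧ ∀ᵐ r ∂μ, β r (q n r) ≠ ⊤ := by
    intro n
    induction n with
    | zero => exact ⟨hg.meas, hg.nonneg, hg.fin⟩
    | succ n ih =>
      obtain ⟨i1, i2, i3⟩ := ih
      refine ⟨Measurable.ite (measurableSet_lt ?_ (measurable_lagrangian_comp hst i1 i2 lam θ))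
        measurable_const i1, fun r => ?_, ?_⟩
      · exact measurable_lagrangian_comp hst measurable_const (fun _ => (he0 n).le) lam θ
      · simp only [q, greedySeq]
        split_ifs
        · exact (he0 n).le
        · exact i2 r
      · filter_upwards [i3] with r hr
        simp only [q, greedySeq]
        split_ifs
        · exact hst.betaFin r _ (he0 n)
        · exact hr
  have hanti : ∀ r, Antitone fun n => lagrangian β X lam θ r (q n r) := fun r =>
    antitone_nat_of_succ_le fun n => (greedySeq_succ_le _ _ _ n r).1
  let d : ℕ → Ω → ℝ≥0∞ := fun n r =>
    ENNReal.ofReal (lagrangian β X lam θ r (p₀ r) - lagrangian β X lam θ r (q n r))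
  have hdm : ∀ n, Measurable (d n) := fun n =>
    ((measurable_lagrangian_comp hst hg.meas hg.nonneg lam θ).sub
      (measurable_lagrangian_comp hst (hq n).1 (hq n).2.1 lam θ)).ennreal_ofReal
  have hdmono : Monotone d := fun m n hmn r =>
    ENNReal.ofReal_le_ofReal (sub_le_sub_left (hanti r hmn) _)
  have hDm : Measurable fun r => ⨆ n, d n r := Measurable.iSup hdm
  have hD : ∫⁻ r, ⨆ n, d n r ∂μ ≤
      ENNReal.ofReal (∫ r, lagrangian β X lam θ r (p₀ r) ∂μ - c) := by
    rw [lintegral_iSup hdm hdmono]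
    exact iSup_le fun n => lintegral_lagrangian_sub_le hst h hg (hq n).1 (hq n).2.1 (hq n).2.2
      (Eventually.of_forall fun r => hanti r (Nat.zero_le n))
  have hDtop : ∫⁻ r, ⨆ n, d n r ∂μ ≠ ⊤ := ne_top_of_le_ne_top ENNReal.ofReal_ne_top hD
  have hDi : Integrable (fun r => (⨆ n, d n r).toReal) μ :=
    integrable_toReal_of_lintegral_ne_top hDm.aemeasurable hDtop
  have hDae := ae_lt_top hDm hDtop
  have hDI : ∫ r, (⨆ n, d n r).toReal ∂μ ≤ ∫ r, lagrangian β X lam θ r (p₀ r) ∂μ - c := by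
    rw [integral_toReal hDm.aemeasurable hDae]
    exact ENNReal.toReal_le_of_le_ofReal (sub_nonneg.2 (h p₀ hg)) hD
  have hfi : Integrable (fun r => ((⨆ n, d n r).toReal - lagrangian β X lam θ r (p₀ r)) / lam) μ :=
    (hDi.sub hgi).div_const lam
  have hbound : Kfun μ β X (θ / lam) (-(1 / lam)) ≤
      eInt μ fun r => ((((⨆ n, d n r).toReal - lagrangian β X lam θ r (p₀ r)) / lam : ℝ) :
        EReal) := by
    refine eInt_mono_ae ?_
    filter_upwards [hDae] with r hr
    rw [conjβ_eq_iSup_rat hst]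
    refine iSup_le fun s => EReal.coe_le_coe_iff.2 ?_
    obtain ⟨n, rfl⟩ := he s
    have h1 : ((e n).1 : ℝ) * (θ / lam + -(1 / lam) * X r) - realβ β r (e n).1 =
        -lagrangian β X lam θ r (e n).1 / lam := by
      rw [lagrangian]
      field_simp
      ring
    have h2 : lagrangian β X lam θ r (q (n + 1) r) ≤ lagrangian β X lam θ r (e n).1 :=
      (greedySeq_succ_le _ _ _ n r).2
    have h3 : lagrangian β X lam θ r (p₀ r) - lagrangian β X lam θ r (q (n + 1) r) ≤
        (⨆ n, d n r).toReal :=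
      (ENNReal.ofReal_le_iff_le_toReal hr.ne).1 (le_iSup (fun n => d n r) (n + 1))
    rw [h1]
    exact div_le_div_of_nonneg_right (by linarith) hlam.le
  refine hbound.trans ?_
  rw [eInt_coe hfi, integral_div, integral_sub hDi hgi]
  exact EReal.coe_le_coe_iff.2 (div_le_div_of_nonneg_right (by linarith) hlam.le)

end Duality

theorem ereal_coe_le_add_div_iff {θ : ℝ} (hθ : θ < 0) (k b : ℝ) (Y : EReal) :
    (b : EReal) ≤ ((k : EReal) + Y) / (θ : EReal) ↔ Y ≤ ((θ * b - k : ℝ) : EReal) := by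
  induction Y with
  | bot => simp [-EReal.coe_sub, -EReal.coe_mul, EReal.bot_div_of_neg_ne_bot (EReal.coe_neg'.2 hθ)]
  | top =>
    simp [-EReal.coe_sub, -EReal.coe_mul, EReal.top_div_of_neg_ne_bot (EReal.coe_neg'.2 hθ)]
  | coe y =>
    rw [← EReal.coe_add, ← EReal.coe_div, EReal.coe_le_coe_iff, EReal.coe_le_coe_iff,
      le_div_iff_of_neg hθ]
    constructor <;> intro <;> linarith

theorem ereal_add_div_le_coe_iff {θ : ℝ} (hθ : θ < 0) (k b : ℝ) (Y : EReal) :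
    ((k : EReal) + Y) / (θ : EReal) ≤ (b : EReal) ↔ ((θ * b - k : ℝ) : EReal) ≤ Y := by
  induction Y with
  | bot => simp [-EReal.coe_sub, -EReal.coe_mul, EReal.bot_div_of_neg_ne_bot (EReal.coe_neg'.2 hθ)]
  | top =>
    simp [-EReal.coe_sub, -EReal.coe_mul, EReal.top_div_of_neg_ne_bot (EReal.coe_neg'.2 hθ)]
  | coe y =>
    rw [← EReal.coe_add, ← EReal.coe_div, EReal.coe_le_coe_iff, EReal.coe_le_coe_iff,
      div_le_iff_of_neg hθ]
    constructor <;> intro <;> linarith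

theorem ereal_coe_le_coe_sub_iff (k x : ℝ) (Y : EReal) :
    (k : EReal) ≤ (x : EReal) - Y ↔ Y ≤ ((x - k : ℝ) : EReal) := by
  induction Y with
  | bot => simp [-EReal.coe_add, -EReal.coe_sub]
  | top => simp [-EReal.coe_add, -EReal.coe_sub]
  | coe y =>
    rw [← EReal.coe_sub, EReal.coe_le_coe_iff, EReal.coe_le_coe_iff]
    constructor <;> intro <;> linarith

theorem ereal_coe_sub_le_coe_iff (k x : ℝ) (Y : EReal) :
    (x : EReal) - Y ≤ (k : EReal) ↔ ((x - k : ℝ) : EReal) ≤ Y := by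
  induction Y with
  | bot => simp [-EReal.coe_add, -EReal.coe_sub]
  | top => simp [-EReal.coe_add, -EReal.coe_sub]
  | coe y =>
    rw [← EReal.coe_sub, EReal.coe_le_coe_iff, EReal.coe_le_coe_iff]
    constructor <;> intro <;> linarith

theorem ereal_sub_coe_le_coe_iff (Y : EReal) (x y : ℝ) :
    Y - (x : EReal) ≤ (y : EReal) ↔ Y ≤ ((x + y : ℝ) : EReal) := by
  induction Y with
  | bot => simp [-EReal.coe_add, -EReal.coe_sub]
  | top => simp [-EReal.coe_add, -EReal.coe_sub]
  | coe z =>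
    rw [← EReal.coe_sub, EReal.coe_le_coe_iff, EReal.coe_le_coe_iff]
    constructor <;> intro <;> linarith

theorem ereal_coe_le_sub_coe_iff (Y : EReal) (x y : ℝ) :
    (y : EReal) ≤ Y - (x : EReal) ↔ ((x + y : ℝ) : EReal) ≤ Y := by
  induction Y with
  | bot => simp [-EReal.coe_add, -EReal.coe_sub]
  | top => simp [-EReal.coe_add, -EReal.coe_sub]
  | coe z =>
    rw [← EReal.coe_sub, EReal.coe_le_coe_iff, EReal.coe_le_coe_iff]
    constructor <;> intro <;> linarith

section Maximisers

variable {Ω : Type*} [MeasurableSpace Ω] {μ : Measure Ω} {β : Ω → ℝ → EReal} {β' : Ω → ℝ → ℝ}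
  {X : Ω → ℝ} {p₀ : Ω → ℝ} {b₀ : ℝ}

theorem le_Kfun (hst : Standing μ β β' X p₀ b₀) {p : Ω → ℝ} (hp : FiniteIntegrals μ β X p)
    (hp1 : ∫ r, p r ∂μ = 1) (θ₁ θ₂ : ℝ) :
    ((θ₁ + θ₂ * ∫ r, X r * p r ∂μ - ∫ r, realβ β r (p r) ∂μ : ℝ) : EReal) ≤
      Kfun μ β X θ₁ θ₂ := by
  have h1 : Integrable (fun r => θ₁ * p r + θ₂ * (X r * p r)) μ :=
    (hp.int.const_mul θ₁).add (hp.intX.const_mul θ₂)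
  have h2 : ∫ r, (θ₁ * p r + θ₂ * (X r * p r)) - realβ β r (p r) ∂μ =
      θ₁ + θ₂ * ∫ r, X r * p r ∂μ - ∫ r, realβ β r (p r) ∂μ := by
    rw [integral_sub h1 hp.intβ, integral_add (hp.int.const_mul θ₁) (hp.intX.const_mul θ₂),
      integral_const_mul, integral_const_mul, hp1, mul_one]
  rw [← h2, ← eInt_coe (f := fun r => θ₁ * p r + θ₂ * (X r * p r) - realβ β r (p r))
    (h1.sub hp.intβ)]
  refine eInt_mono_ae ?_
  filter_upwards [hp.fin] with r hr
  refine le_of_eq_of_le ?_ (le_conjβ hst r (θ₁ + θ₂ * X r) hr)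
  congr 1
  ring

theorem Kfun_ne_bot (hst : Standing μ β β' X p₀ b₀) (θ₁ θ₂ : ℝ) : Kfun μ β X θ₁ θ₂ ≠ ⊥ := by
  obtain ⟨hg, hg1, -, -⟩ := FiniteIntegrals.reference hst
  exact ne_bot_of_le_ne_bot (EReal.coe_ne_bot _) (le_Kfun hst hg hg1 θ₁ θ₂)

theorem Vfun_le_integral (hst : Standing μ β β' X p₀ b₀) {k b : ℝ}
    (hb : Vfun μ β X k = (b : EReal)) {p : Ω → ℝ} (hp : FiniteIntegrals μ β X p)
    (hp1 : ∫ r, p r ∂μ = 1) (hk : ∫ r, realβ β r (p r) ∂μ ≤ k) : b ≤ ∫ r, X r * p r ∂μ := by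
  rw [← EReal.coe_le_coe_iff, ← hb, ← eInt_coe hp.intX]
  refine iInf_le (fun p : {p : Ω → ℝ // IsDensity μ p ∧ Hfun μ β p ≤ (k : EReal)} => xInt μ X p.1)
    ⟨p, isDensity_iff_integral.2 ⟨hp.meas, hp.nonneg, hp.int, hp1⟩, ?_⟩
  rw [hp.Hfun_eq hst]
  exact EReal.coe_le_coe_iff.2 hk

theorem exists_near_Vfun (hst : Standing μ β β' X p₀ b₀) {k b : ℝ}
    (hb : Vfun μ β X k = (b : EReal)) {c : ℝ} (hc : b < c) :
    ∃ p, FiniteIntegrals μ β X p ∧ ∫ r, p r ∂μ = 1 ∧ ∫ r, realβ β r (p r) ∂μ ≤ k ∧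
      ∫ r, X r * p r ∂μ < c := by
  have h1 : Vfun μ β X k < (c : EReal) := hb ▸ EReal.coe_lt_coe_iff.2 hc
  obtain ⟨⟨p, hp, hpk⟩, hpc⟩ := iInf_lt_iff.1 h1
  have hbp : (b : EReal) ≤ xInt μ X p := hb ▸ iInf_le _ (⟨p, hp, hpk⟩ :
    {p : Ω → ℝ // IsDensity μ p ∧ Hfun μ β p ≤ (k : EReal)})
  obtain ⟨h1, h2, h3, h4⟩ := FiniteIntegrals.of_Hfun_le hst hp hpk hpc.ne_top
    (ne_bot_of_le_ne_bot (EReal.coe_ne_bot b) hbp)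
  exact ⟨p, h1, h2, EReal.coe_le_coe_iff.1 (h3 ▸ hpk), EReal.coe_lt_coe_iff.1 (h4 ▸ hpc)⟩

theorem Vfun_le_payoff (hst : Standing μ β β' X p₀ b₀) {k b : ℝ} (hk0 : 0 < k)
    (hb : Vfun μ β X k = (b : EReal)) : b ≤ b₀ := by
  obtain ⟨hg, hg1, hg2, hg3⟩ := FiniteIntegrals.reference hst
  exact hg3 ▸ Vfun_le_integral hst hb hg hg1 (hg2.trans_le hk0.le)

theorem le_Kfun_of_Vfun (hst : Standing μ β β' X p₀ b₀) {k b : ℝ} (hk0 : 0 < k)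
    (hb : Vfun μ β X k = (b : EReal)) (θ₁ θ₂ : ℝ) :
    ((θ₁ + θ₂ * b - k : ℝ) : EReal) ≤ Kfun μ β X θ₁ θ₂ := by
  rcases le_or_gt 0 θ₂ with h | h
  · obtain ⟨hg, hg1, hg2, hg3⟩ := FiniteIntegrals.reference hst
    refine le_trans (EReal.coe_le_coe_iff.2 ?_) (le_Kfun hst hg hg1 θ₁ θ₂)
    rw [hg2, hg3]
    nlinarith [mul_le_mul_of_nonneg_left (Vfun_le_payoff hst hk0 hb) h]
  · refine EReal.ge_of_forall_gt_iff_ge.1 fun z hz => ?_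
    rw [EReal.coe_lt_coe_iff] at hz
    have hδ : 0 < (θ₁ + θ₂ * b - k - z) / (-θ₂) := div_pos (by linarith) (by linarith)
    obtain ⟨p, hp, hp1, hp2, hp3⟩ := exists_near_Vfun hst hb (lt_add_of_pos_right b hδ)
    refine le_trans (EReal.coe_le_coe_iff.2 ?_) (le_Kfun hst hp hp1 θ₁ θ₂)
    rw [← sub_lt_iff_lt_add', lt_div_iff₀ (by linarith)] at hp3
    linarith

theorem essInfX_lt_Vfun (hst : Standing μ β β' X p₀ b₀) {k b : ℝ} (hk0 : 0 < k)
    (hkmax : (k : EReal) < kmax μ β X b₀) (hb : Vfun μ β X k = (b : EReal)) :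
    essInfX μ X < (b : EReal) := by
  obtain ⟨hg, hg1, hg2, hg3⟩ := FiniteIntegrals.reference hst
  obtain ⟨⟨c, hmc, hcb⟩, hkc⟩ := lt_iSup_iff.1 hkmax
  refine hmc.trans_le (EReal.coe_le_coe_iff.2 (not_lt.1 fun hbc => ?_))
  obtain ⟨p, hp, hp1, hp2, hp3⟩ := exists_near_Vfun hst hb hbc
  set x := ∫ r, X r * p r ∂μ with hx
  have hd : 0 < b₀ - x := by linarith [show c < b₀ from hcb]
  have hu : 0 ≤ (b₀ - c) / (b₀ - x) := div_nonneg (by linarith [show c < b₀ from hcb]) hd.le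
  have hu1 : (b₀ - c) / (b₀ - x) ≤ 1 := (div_le_one hd).2 (by linarith [show x < c from hp3])
  have hv : 0 ≤ (c - x) / (b₀ - x) := div_nonneg (by linarith [show x < c from hp3]) hd.le
  obtain ⟨hm, hle⟩ := hp.mix hst hg hu hv (by field_simp; ring)
  refine absurd hkc (not_lt.2 ?_)
  refine le_trans (iInf_le (fun p : {p : Ω → ℝ // IsDensity μ p ∧ xInt μ X p = (c : EReal)} =>
    Hfun μ β p.1) ⟨_, isDensity_iff_integral.2 ⟨hm.meas, hm.nonneg, hm.int, ?_⟩, ?_⟩) ?_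
  · rw [integral_add (hp.int.const_mul _) (hg.int.const_mul _), integral_const_mul,
      integral_const_mul, hp1, hg1]
    field_simp
    ring
  · rw [xInt, eInt_coe hm.intX, integral_mul_mix hp.intX hg.intX, ← hx, hg3]
    congr 1
    field_simp
    ring
  · rw [hm.Hfun_eq hst]
    refine EReal.coe_le_coe_iff.2 (hle.trans ?_)
    rw [hg2, mul_zero, add_zero]
    nlinarith [mul_le_mul_of_nonneg_left hp2 hu]

/-- Attained strong duality for the worst case problem. -/
theorem exists_Kfun_le_of_Vfun (hst : Standing μ β β' X p₀ b₀) {k b : ℝ} (hk0 : 0 < k)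
    (hkmax : (k : EReal) < kmax μ β X b₀) (hb : Vfun μ β X k = (b : EReal)) :
    ∃ θ₁ θ₂ : ℝ, θ₂ < 0 ∧ Kfun μ β X θ₁ θ₂ ≤ ((θ₁ + θ₂ * b - k : ℝ) : EReal) := by
  obtain ⟨hg, hg1, hg2, hg3⟩ := FiniteIntegrals.reference hst
  let S : Set (ℝ × ℝ) := {x | ∃ p, FiniteIntegrals μ β X p ∧ ∫ r, p r ∂μ = 1 ∧
    ∫ r, realβ β r (p r) ∂μ ≤ x.1 ∧ ∫ r, X r * p r ∂μ = x.2}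
  have hS : Convex ℝ S := by
    rintro x ⟨p, hp, hp1, hp2, hp3⟩ y ⟨q, hq, hq1, hq2, hq3⟩ a b ha hb hab
    obtain ⟨hm, hle⟩ := hp.mix hst hq ha hb hab
    refine ⟨_, hm, ?_, hle.trans ?_, ?_⟩
    · rw [integral_add (hp.int.const_mul a) (hq.int.const_mul b), integral_const_mul,
        integral_const_mul, hp1, hq1, mul_one, mul_one, hab]
    · simp only [Prod.fst_add, Prod.smul_fst, smul_eq_mul]
      gcongr
    · simp only [Prod.snd_add, Prod.smul_snd, smul_eq_mul]
      rw [integral_mul_mix hp.intX hq.intX, hp3, hq3]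
  have hgS : ∀ h : ℝ, 0 ≤ h → (h, b₀) ∈ S := fun h hh => ⟨p₀, hg, hg1, hg2.trans_le hh, hg3⟩
  obtain ⟨η, hη⟩ := exists_supporting_slope hS (a := k) (c := b)
    (fun x ⟨p, hp, hp1, hp2, hp3⟩ => (Vfun_le_integral hst hb hp hp1 hp2).trans_eq hp3)
    ⟨_, hgS 0 le_rfl, hk0⟩ ⟨_, hgS (k + 1) (by linarith), lt_add_one k⟩
  have hη0 : η ≤ 0 := by
    by_contra! hpos
    have hb₀ := Vfun_le_payoff hst hk0 hb
    have hn : 0 ≤ (b₀ - b) / η := div_nonneg (by linarith) hpos.le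
    have h1 := hη _ (hgS (k + (b₀ - b) / η + 1) (by linarith))
    have h2 : η * ((b₀ - b) / η) = b₀ - b := mul_div_cancel₀ _ hpos.ne'
    simp only at h1
    nlinarith
  have hL : ∀ p, FiniteIntegrals μ β X p → ∫ r, p r ∂μ = 1 →
      b + -η * k ≤ ∫ r, X r * p r ∂μ + -η * ∫ r, realβ β r (p r) ∂μ := fun p hp hp1 => by
    have := hη (_, _) ⟨p, hp, hp1, le_rfl, rfl⟩
    simp only at this
    linarith
  have hηneg : η < 0 := by
    refine lt_of_le_of_ne hη0 fun h0 => ?_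
    refine absurd (essInfX_lt_Vfun hst hk0 hkmax hb) (not_lt.2 ?_)
    refine le_essInfX_of_forall_le hst fun p hp hp1 => ?_
    simpa [h0] using hL p hp hp1
  have hlam : 0 < -η := neg_pos.2 hηneg
  obtain ⟨θ, hθ⟩ := exists_mass_multiplier hst hlam.le hL
  have hK := Kfun_le_of_forall_le hst (θ := θ) (c := b + -η * k - θ) hlam fun p hp => by
    rw [(hp.integral_lagrangian (-η) θ).2]
    linarith [hθ p hp]
  have hne : η ≠ 0 := hηneg.ne
  refine ⟨_, _, neg_lt_zero.2 (one_div_pos.2 hlam), hK.trans_eq ?_⟩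
  congr 1
  field_simp
  ring

theorem conjβ_ne_top_and_integrable (hst : Standing μ β β' X p₀ b₀) {θ₁ θ₂ : ℝ}
    (h : Kfun μ β X θ₁ θ₂ ≠ ⊤) :
    (∀ᵐ r ∂μ, conjβ β r (θ₁ + θ₂ * X r) ≠ ⊤) ∧
      Integrable (fun r => (conjβ β r (θ₁ + θ₂ * X r)).toReal) μ ∧
      Kfun μ β X θ₁ θ₂ = ((∫ r, (conjβ β r (θ₁ + θ₂ * X r)).toReal ∂μ : ℝ) : EReal) := by
  obtain ⟨h1, -, h2, h3⟩ := integrable_of_eInt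
    (measurable_conjβ_comp hst ((hst.Xmeas.const_mul θ₂).const_add θ₁)) h (Kfun_ne_bot hst θ₁ θ₂)
  exact ⟨h1, h2, h3⟩

theorem Kfun_mono (hst : Standing μ β β' X p₀ b₀) {θ₁ θ₁' : ℝ} (h : θ₁' ≤ θ₁) (θ₂ : ℝ) :
    Kfun μ β X θ₁' θ₂ ≤ Kfun μ β X θ₁ θ₂ :=
  eInt_mono_ae (Eventually.of_forall fun r => conjβ_mono hst r (by gcongr))

/-- If `τ` is not below `β'(r,+∞)`, the left difference quotients of the conjugate at `τ` exceed
every bound. -/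
theorem eventually_le_conjβ_quotient (hst : Standing μ β β' X p₀ b₀) {r : Ω} {τ : ℝ}
    (hτ : derivTop β' r ≤ (τ : EReal)) (hfin : conjβ β r τ ≠ ⊤) {s : ℝ} (hs : 0 < s) :
    ∀ᶠ ε in 𝓝[>] (0 : ℝ),
      s ≤ ((conjβ β r τ).toReal - (conjβ β r (τ - ε)).toReal) / ε := by
  have hder : ∀ t, 0 < t → β' r t ≤ τ := fun t ht => EReal.coe_le_coe_iff.1
    ((le_iSup (fun s : {s : ℝ // 0 < s} => (β' r s.1 : EReal)) ⟨t, ht⟩).trans hτ)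
  set g : ℝ → ℝ := fun t => t * τ - realβ β r t with hg
  have hgd : ∀ t ∈ Ioi (0 : ℝ), HasDerivAt g (τ - β' r t) t := fun t ht => by
    have h := ((hasDerivAt_id t).mul_const τ).sub (hst.betaDeriv r t ht)
    rw [one_mul] at h
    exact h
  have hmono : MonotoneOn g (Ioi 0) := by
    refine monotoneOn_of_deriv_nonneg (convex_Ioi 0)
      (fun t ht => (hgd t ht).continuousAt.continuousWithinAt)
      (fun t ht => (hgd t (interior_subset ht)).differentiableAt.differentiableWithinAt)
      fun t ht => ?_
    rw [(hgd t (interior_subset ht)).deriv]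
    exact sub_nonneg.2 (hder t (interior_subset ht))
  have hstrict : g s < g (3 * s) := by
    have h1 := (hst.betaConv r).2 (mem_Ioi.2 hs) (show 3 * s ∈ Ioi 0 from mem_Ioi.2 (by positivity))
      (by linarith : s < 3 * s).ne (half_pos one_pos) (half_pos one_pos) (add_halves (1 : ℝ))
    simp only [smul_eq_mul, show 1 / 2 * s + 1 / 2 * (3 * s) = 2 * s by ring] at h1
    have h3 : g (2 * s) ≤ g (3 * s) :=
      hmono (mem_Ioi.2 (by positivity)) (mem_Ioi.2 (by positivity)) (by linarith)
    simp only [hg, realβ] at h3 ⊢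
    linarith
  set v := (conjβ β r τ).toReal with hv
  have hle : ∀ t, 0 < t → g t ≤ v := fun t ht => by
    have h1 := le_conjβ hst r τ (hst.betaFin r t ht)
    rw [← EReal.coe_toReal hfin (conjβ_ne_bot hst r τ)] at h1
    exact EReal.coe_le_coe_iff.1 h1
  have hgap : 0 < v - g s := by linarith [hle (3 * s) (by positivity)]
  have hε₀ : 0 < (v - g s) / s := by positivity
  filter_upwards [Ioo_mem_nhdsGT hε₀] with ε hε
  obtain ⟨hε0, hε1⟩ := hε
  rw [lt_div_iff₀ hs] at hε1
  have hbound : conjβ β r (τ - ε) ≤ ((v - ε * s : ℝ) : EReal) := by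
    rw [conjβ_eq_iSup_rat hst]
    refine iSup_le fun q => EReal.coe_le_coe_iff.2 ?_
    have hq : (0 : ℝ) < q.1 := by exact_mod_cast q.2
    have he : (q.1 : ℝ) * (τ - ε) - realβ β r q.1 = g q.1 - ε * q.1 := by
      simp only [hg]
      ring
    rw [he]
    rcases le_total (q.1 : ℝ) s with h | h
    · have := hmono hq hs h
      nlinarith [mul_pos hε0 hq]
    · nlinarith [hle q.1 hq]
  have h1 := EReal.toReal_le_toReal hbound (conjβ_ne_bot hst r _) (EReal.coe_ne_top _)
  rw [EReal.toReal_coe] at h1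
  rw [le_div_iff₀ hε0]
  linarith

theorem mem_ThetaSet_and_pInt_le (hst : Standing μ β β' X p₀ b₀) {ψ : Ω → ℝ → ℝ}
    (hψ : IsConjDeriv β β' ψ) {θ₁ θ₂ : ℝ} (htop : Kfun μ β X θ₁ θ₂ ≠ ⊤)
    (hmin : ∀ ε : ℝ, 0 < ε → Kfun μ β X θ₁ θ₂ ≤ Kfun μ β X (θ₁ - ε) θ₂ + (ε : EReal)) :
    (θ₁, θ₂) ∈ ThetaSet μ β β' X ∧ pInt μ (pFam ψ X θ₁ θ₂) ≤ 1 := by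
  obtain ⟨hfin, hint, hK⟩ := conjβ_ne_top_and_integrable hst htop
  let ε : ℕ → ℝ := fun n => 1 / ((n : ℝ) + 1)
  have hε : ∀ n, 0 < ε n := fun n => Nat.one_div_pos_of_nat
  have hε0 : Tendsto ε atTop (𝓝[>] 0) := tendsto_nhdsWithin_iff.2
    ⟨tendsto_one_div_add_atTop_nhds_zero_nat, Eventually.of_forall hε⟩
  let Q : ℕ → Ω → ℝ := fun n r => ((conjβ β r (θ₁ + θ₂ * X r)).toReal -
    (conjβ β r (θ₁ + θ₂ * X r - ε n)).toReal) / ε n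
  have hsub : ∀ n r, θ₁ + θ₂ * X r - ε n = θ₁ - ε n + θ₂ * X r := fun n r => by ring
  have hτm : Measurable fun r => θ₁ + θ₂ * X r := (hst.Xmeas.const_mul θ₂).const_add θ₁
  have hQm : ∀ n, Measurable fun r => ENNReal.ofReal (Q n r) := fun n =>
    (((measurable_conjβ_comp hst hτm).ereal_toReal.sub
      (measurable_conjβ_comp hst (hτm.sub_const (ε n))).ereal_toReal).div_const
        (ε n)).ennreal_ofReal
  have hQle : ∀ n, ∫⁻ r, ENNReal.ofReal (Q n r) ∂μ ≤ 1 := by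
    intro n
    obtain ⟨-, hint', hK'⟩ := conjβ_ne_top_and_integrable hst (θ₁ := θ₁ - ε n) (θ₂ := θ₂)
      (ne_top_of_le_ne_top htop (Kfun_mono hst (by linarith [hε n]) θ₂))
    simp only [← hsub] at hint' hK'
    have hQi : Integrable (Q n) μ := (hint.sub hint').div_const (ε n)
    have hQ0 : 0 ≤ᵐ[μ] Q n := by
      filter_upwards [hfin] with r hr
      refine div_nonneg (sub_nonneg.2 ?_) (hε n).le
      exact EReal.toReal_le_toReal (conjβ_mono hst r (by linarith [hε n]))
        (conjβ_ne_bot hst r _) hr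
    rw [← ofReal_integral_eq_lintegral_ofReal hQi hQ0, ← ENNReal.ofReal_one]
    refine ENNReal.ofReal_le_ofReal ?_
    have h1 := hmin (ε n) (hε n)
    rw [hK, hK', ← EReal.coe_add, EReal.coe_le_coe_iff] at h1
    rw [integral_div, integral_sub hint hint', div_le_one (hε n)]
    linarith
  have hliminf : ∫⁻ r, liminf (fun n => ENNReal.ofReal (Q n r)) atTop ∂μ ≤ 1 := by
    refine (lintegral_liminf_le hQm).trans ?_
    refine liminf_le_of_frequently_le' ?_
    exact (Eventually.of_forall hQle).frequently
  have hlt : ∀ᵐ r ∂μ, ((θ₁ + θ₂ * X r : ℝ) : EReal) < derivTop β' r := by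
    have hm : Measurable fun r => liminf (fun n => ENNReal.ofReal (Q n r)) atTop :=
      Measurable.liminf hQm
    filter_upwards [hfin, ae_lt_top hm (ne_top_of_le_ne_top ENNReal.one_ne_top hliminf)]
      with r hr hlim
    by_contra hτ
    refine hlim.ne (ENNReal.eq_top_of_forall_nnreal_le fun s => ?_)
    refine le_liminf_of_le (by isBoundedDefault) ?_
    filter_upwards [hε0.eventually (eventually_le_conjβ_quotient hst (not_lt.1 hτ) hr
      (s := s + 1) (by positivity))] with n hn
    rw [← ENNReal.ofReal_coe_nnreal]
    exact ENNReal.ofReal_le_ofReal (by linarith)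
  refine ⟨⟨lt_top_iff_ne_top.2 htop, hlt⟩, ?_⟩
  refine le_trans (le_of_eq (lintegral_congr_ae ?_)) hliminf
  filter_upwards [hlt] with r hr
  have hderiv := hψ r _ hr
  have ht : Tendsto (fun n => Q n r) atTop (𝓝 (ψ r (θ₁ + θ₂ * X r))) := by
    have h1 := hderiv.tendsto_slope.comp
      (f := fun n => θ₁ + θ₂ * X r - ε n) (x := atTop) (tendsto_nhdsWithin_iff.2 ⟨?_, ?_⟩)
    · refine h1.congr fun n => ?_
      simp only [Function.comp_apply, slope_def_field, Q]
      rw [sub_sub_cancel_left, div_neg, ← neg_div, neg_sub]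
    · simpa using (tendsto_const_nhds (x := θ₁ + θ₂ * X r)).sub
        (tendsto_nhds_of_tendsto_nhdsWithin hε0)
    · refine Eventually.of_forall fun n => ?_
      have := hε n
      simp only [mem_compl_iff, mem_singleton_iff]
      linarith
  exact ((ENNReal.continuous_ofReal.tendsto _).comp ht).liminf_eq.symm

end Maximisers

/-- maximisers in Theorem 1. Let `k ∈ (0, k_max)` and `b := V(k)`.
A `θ₂ < 0` attains `max_{θ₂<0} (k + G(θ₂))/θ₂` iff it attains
`sup_{θ₂} [θ₂ b − G(θ₂)]`; a pair `(θ₁,θ₂)`, `θ₂ < 0`, attains the double maximum iff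
it attains `sup [θ₁ + θ₂ b − K(θ₁,θ₂)]`; any such pair belongs to `Θ` and satisfies
`∫ p_{θ₁,θ₂} dμ ≤ 1`. -/
theorem maximisers_characterisation {Ω : Type*} [MeasurableSpace Ω] (μ : Measure Ω)
    (β : Ω → ℝ → EReal) (β' : Ω → ℝ → ℝ) (ψ : Ω → ℝ → ℝ) (X : Ω → ℝ) (p₀ : Ω → ℝ) (b₀ : ℝ)
    (hst : Standing μ β β' X p₀ b₀) (hψ : IsConjDeriv β β' ψ)
    (k : ℝ) (hk0 : 0 < k) (hkmax : (k : EReal) < kmax μ β X b₀)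
    (b : ℝ) (hb : Vfun μ β X k = (b : EReal)) :
    (∀ θ₂ : ℝ, θ₂ < 0 →
      ((∀ θ₂' : ℝ, θ₂' < 0 →
          ((k : EReal) + Gfun μ β X θ₂') / ((θ₂' : ℝ) : EReal) ≤
            ((k : EReal) + Gfun μ β X θ₂) / ((θ₂ : ℝ) : EReal)) ↔
        (∀ θ₂' : ℝ,
          ((θ₂' * b : ℝ) : EReal) - Gfun μ β X θ₂' ≤
            ((θ₂ * b : ℝ) : EReal) - Gfun μ β X θ₂))) ∧
    (∀ θ₁ θ₂ : ℝ, θ₂ < 0 →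
      (IsWCLParam μ β X k θ₁ θ₂ ↔
        (∀ θ₁' θ₂' : ℝ,
          ((θ₁' + θ₂' * b : ℝ) : EReal) - Kfun μ β X θ₁' θ₂' ≤
            ((θ₁ + θ₂ * b : ℝ) : EReal) - Kfun μ β X θ₁ θ₂))) ∧
    (∀ θ₁ θ₂ : ℝ, IsWCLParam μ β X k θ₁ θ₂ →
      (θ₁, θ₂) ∈ ThetaSet μ β β' X ∧ pInt μ (pFam ψ X θ₁ θ₂) ≤ 1) := by
  have hG : ∀ θ : ℝ, ((θ * b - k : ℝ) : EReal) ≤ Gfun μ β X θ := fun θ => le_iInf fun θ₁ =>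
    (ereal_coe_le_sub_coe_iff _ _ _).2
      ((le_Kfun_of_Vfun hst hk0 hb θ₁ θ).trans' (by rw [add_sub_assoc]))
  have hK : ∀ θ₁ θ₂ : ℝ,
      ((θ₂ * b - k : ℝ) : EReal) ≤ Kfun μ β X θ₁ θ₂ - (θ₁ : EReal) := fun θ₁ θ₂ =>
    (hG θ₂).trans (iInf_le _ θ₁)
  obtain ⟨t₁, t₂, ht, htK⟩ := exists_Kfun_le_of_Vfun hst hk0 hkmax hb
  have htK' : Kfun μ β X t₁ t₂ - (t₁ : EReal) ≤ ((t₂ * b - k : ℝ) : EReal) := by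
    rwa [ereal_sub_coe_le_coe_iff, ← add_sub_assoc]
  have htG : Gfun μ β X t₂ ≤ ((t₂ * b - k : ℝ) : EReal) := (iInf_le _ t₁).trans htK'
  have hWCL : ∀ θ₁ θ₂ : ℝ, IsWCLParam μ β X k θ₁ θ₂ ↔
      θ₂ < 0 ∧ Kfun μ β X θ₁ θ₂ ≤ ((θ₁ + θ₂ * b - k : ℝ) : EReal) := by
    intro θ₁ θ₂
    refine and_congr_right fun hθ => ?_
    simp only [sub_eq_add_neg (_ + _) (Real.toEReal _), add_assoc (k : EReal)]
    simp only [← sub_eq_add_neg]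
    rw [add_sub_assoc, ← ereal_sub_coe_le_coe_iff, ← ereal_coe_le_add_div_iff hθ]
    exact ⟨fun h => ((ereal_coe_le_add_div_iff ht k b _).2 htK').trans (h t₁ t₂ ht),
      fun h θ₁' θ₂' hθ' => ((ereal_add_div_le_coe_iff hθ' k b _).2 (hK θ₁' θ₂')).trans h⟩
  refine ⟨fun θ₂ hθ => ⟨fun h θ₂' => ?_, fun h θ₂' hθ' => ?_⟩, fun θ₁ θ₂ hθ => ?_,
    fun θ₁ θ₂ h => ?_⟩
  · exact ((ereal_coe_sub_le_coe_iff k _ _).2 (hG θ₂')).trans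
      ((ereal_coe_le_coe_sub_iff k _ _).2 ((ereal_coe_le_add_div_iff hθ k b _).1
        (((ereal_coe_le_add_div_iff ht k b _).2 htG).trans (h t₂ ht))))
  · exact ((ereal_add_div_le_coe_iff hθ' k b _).2 (hG θ₂')).trans
      ((ereal_coe_le_add_div_iff hθ k b _).2 ((ereal_coe_le_coe_sub_iff k _ _).1
        (((ereal_coe_le_coe_sub_iff k _ _).2 htG).trans (h t₂))))
  · rw [hWCL, and_iff_right hθ, ← ereal_coe_le_coe_sub_iff]
    exact ⟨fun h θ₁' θ₂' => ((ereal_coe_sub_le_coe_iff k _ _).2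
      (le_Kfun_of_Vfun hst hk0 hb θ₁' θ₂')).trans h,
      fun h => ((ereal_coe_le_coe_sub_iff k _ _).2 htK).trans (h t₁ t₂)⟩
  · have hle := ((hWCL θ₁ θ₂).1 h).2
    refine mem_ThetaSet_and_pInt_le hst hψ (ne_top_of_le_ne_top (EReal.coe_ne_top _) hle)
      fun ε _ => hle.trans ?_
    refine le_trans ?_ (add_le_add_left (le_Kfun_of_Vfun hst hk0 hb (θ₁ - ε) θ₂) (ε : EReal))
    rw [← EReal.coe_add]
    exact EReal.coe_le_coe_iff.2 (by linarith)
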